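/- Suppose the delayed mass-action system is a DeCBMAS and the network is a combination of ℓ subnetworks each of which is a 2d sub-DeCBMAS. If every semilocking set W of the combined network is in Case I (some W^(p) is a facet-type semilocking set of subnetwork p) and satisfies W ∩ S_c = ∅, then the system is persistent. -/

import Mathlib

open Finset Filter

variable {n r : ℕ}

/-- Mass-action monomial `x^y = ∏ j, x j ^ y j`. -/
def mono (x : Fin n → ℝ) (y : Fin n → ℕ) : ℝ := ∏ j, x j ^ y j

/-- A (bounded-domain) solution of the delayed mass-action system whose reactions are
those in the index set `R` (with reactant complexes `y`, product complexes `y'`,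
rate constants `k`, delays `τ`, and maximal delay `τm`):
nonnegative, continuous on `[-τm, ∞)`, and satisfying the delay differential equation
`x'(t) = ∑ i ∈ R, k i (x(t-τ i)^{y i} • y' i - x(t)^{y i} • y i)` for `t > 0`. -/
def IsSolutionOn (y y' : Fin r → Fin n → ℕ) (k τ : Fin r → ℝ) (τm : ℝ)
    (R : Finset (Fin r)) (x : ℝ → Fin n → ℝ) : Prop :=
  (∀ t ∈ Set.Ici (-τm), ∀ j, 0 ≤ x t j) ∧
  ContinuousOn x (Set.Ici (-τm)) ∧
  ∀ t > (0 : ℝ), HasDerivAt x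
    (fun j => ∑ i ∈ R, k i * (mono (x (t - τ i)) (y i) * (y' i j : ℝ)
      - mono (x t) (y i) * (y i j : ℝ))) t

/-- A solution of the full delayed mass-action system. -/
def IsSolution (y y' : Fin r → Fin n → ℕ) (k τ : Fin r → ℝ) (τm : ℝ)
    (x : ℝ → Fin n → ℝ) : Prop :=
  IsSolutionOn y y' k τ τm Finset.univ x

/-- Positive initial condition: `x` is strictly positive on `[-τm, 0]`. -/
def PosInit (τm : ℝ) (x : ℝ → Fin n → ℝ) : Prop :=
  ∀ t ∈ Set.Icc (-τm) 0, ∀ j, 0 < x t j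

/-- The solution is bounded on `[-τm, ∞)`. -/
def BoundedSol (τm : ℝ) (x : ℝ → Fin n → ℝ) : Prop :=
  ∃ M : ℝ, ∀ t ∈ Set.Ici (-τm), ‖x t‖ ≤ M

/-- The (sub)system consisting of the reactions in `R` is complex balanced:
there is a positive state `xb` at which, for every complex `η`, the inflow and
outflow rates of `η` coincide. -/
def ComplexBalancedOn (y y' : Fin r → Fin n → ℕ) (k : Fin r → ℝ)
    (R : Finset (Fin r)) : Prop :=
  ∃ xb : Fin n → ℝ, (∀ j, 0 < xb j) ∧ ∀ η : Fin n → ℕ,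
    ∑ i ∈ R.filter (fun i => y i = η), k i * mono xb (y i)
      = ∑ i ∈ R.filter (fun i => y' i = η), k i * mono xb (y i)

/-- `W` is a semilocking set for the reactions in `R`. -/
def Semilocking (y y' : Fin r → Fin n → ℕ) (R : Finset (Fin r)) (W : Set (Fin n)) : Prop :=
  W.Nonempty ∧ ∀ i ∈ R, (∃ j ∈ W, y' i j ≠ 0) → ∃ j ∈ W, y i j ≠ 0

/-- Stoichiometric subspace spanned by the reaction vectors of the reactions in `R`. -/
def stoichOn (y y' : Fin r → Fin n → ℕ) (R : Finset (Fin r)) : Submodule ℝ (Fin n → ℝ) :=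
  Submodule.span ℝ {v | ∃ i ∈ R, v = fun j => (y' i j : ℝ) - (y i j : ℝ)}

/-- `W` is vertex-type w.r.t. the subspace `V`: the only `v ∈ V` vanishing on `W` is `0`. -/
def VertexType (V : Submodule ℝ (Fin n → ℝ)) (W : Set (Fin n)) : Prop :=
  ∀ v ∈ V, (∀ j ∈ W, v j = 0) → v = 0

/-- `W` is facet-type w.r.t. the subspace `V`: the projection of `V` onto the
coordinates outside `W` has dimension `dim V - 1`. -/
def FacetType (V : Submodule ℝ (Fin n → ℝ)) (W : Set (Fin n)) : Prop :=
  Module.finrank ℝ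
      (V.map (LinearMap.funLeft ℝ ℝ (Subtype.val : {j : Fin n // j ∉ W} → Fin n)))
    = Module.finrank ℝ V - 1

/-- The network is a combination of subnetworks with species sets `Sp p` and with
reaction `i` assigned to subnetwork `grp i`. -/
def IsCombination {l : ℕ} (y y' : Fin r → Fin n → ℕ) (Sp : Fin l → Set (Fin n))
    (grp : Fin r → Fin l) : Prop :=
  (∀ j, ∃ p, j ∈ Sp p) ∧ ∀ i j, (y i j ≠ 0 ∨ y' i j ≠ 0) → j ∈ Sp (grp i)

/-- The reaction index set of subnetwork `p`. -/
def Rgrp {l : ℕ} (grp : Fin r → Fin l) (p : Fin l) : Finset (Fin r) :=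
  Finset.univ.filter (fun i => grp i = p)

/-- The set `S_c` of intersecting species. -/
def interSpecies {l : ℕ} (Sp : Fin l → Set (Fin n)) : Set (Fin n) :=
  {j | ∃ p q, p ≠ q ∧ j ∈ Sp p ∧ j ∈ Sp q}

/-- `W^{cn}`: species outside `W` lying in some subnetwork `p'` with `W ∩ S^(p') = ∅`. -/
def Wcn {l : ℕ} (Sp : Fin l → Set (Fin n)) (W : Set (Fin n)) : Set (Fin n) :=
  {j | j ∉ W ∧ ∃ p, W ∩ Sp p = ∅ ∧ j ∈ Sp p}

/-- `W^{tf}`: completely unrestricted species outside `W`: they occur in some reaction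
all of whose species lie outside `W`. -/
def Wtf (y y' : Fin r → Fin n → ℕ) (W : Set (Fin n)) : Set (Fin n) :=
  {j | j ∉ W ∧ ∃ i, (y i j ≠ 0 ∨ y' i j ≠ 0) ∧
    ∀ j', (y i j' ≠ 0 ∨ y' i j' ≠ 0) → j' ∉ W}

/-- `W^{tr}`: totally restricted species outside `W`: every stoichiometric vector
vanishing on `W` also vanishes at `j`. -/
def Wtr (y y' : Fin r → Fin n → ℕ) (W : Set (Fin n)) : Set (Fin n) :=
  {j | j ∉ W ∧ ∀ v ∈ stoichOn y y' Finset.univ, (∀ j' ∈ W, v j' = 0) → v j = 0}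

/-- `θ` (a function on `[-τm,0]`) is an ω-limit point of the solution `x`. -/
def OmegaLimitPt (τm : ℝ) (x θ : ℝ → Fin n → ℝ) : Prop :=
  ContinuousOn θ (Set.Icc (-τm) 0) ∧ (∀ s ∈ Set.Icc (-τm) 0, ∀ j, 0 ≤ θ s j) ∧
  ∃ tN : ℕ → ℝ, Tendsto tN atTop atTop ∧
    ∀ ε > (0 : ℝ), ∃ N₀, ∀ N ≥ N₀, ∀ s ∈ Set.Icc (-τm) 0, ‖x (tN N + s) - θ s‖ < ε

/-- `θ` lies on the boundary `L_W`: it vanishes identically on the coordinates of `W`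
and is nowhere zero on the coordinates outside `W`. -/
def OnBoundary (τm : ℝ) (W : Set (Fin n)) (θ : ℝ → Fin n → ℝ) : Prop :=
  (∀ s ∈ Set.Icc (-τm) 0, ∀ j ∈ W, θ s j = 0) ∧
  ∀ s ∈ Set.Icc (-τm) 0, ∀ j ∉ W, θ s j ≠ 0

/-- Persistence of the delayed mass-action system: every bounded solution with
positive initial condition has `liminf_{t→∞} x_j(t) > 0` for every species `j`. -/
def Persistent (y y' : Fin r → Fin n → ℕ) (k τ : Fin r → ℝ) (τm : ℝ) : Prop :=
  ∀ x : ℝ → Fin n → ℝ, IsSolution y y' k τ τm x → PosInit τm x → BoundedSol τm x →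
    ∀ j, 0 < liminf (fun t => x t j) atTop



lemma mvt_lower {f f' : ℝ → ℝ} {s t m : ℝ} (hst : s ≤ t)
    (hf : ∀ u ∈ Set.Icc s t, HasDerivAt f (f' u) u) (hm : ∀ u ∈ Set.Icc s t, m ≤ f' u) :
    f s + m * (t - s) ≤ f t := by
  have h := (convex_Icc s t).mul_sub_le_image_sub_of_le_deriv (f := f) (C := m)
    (fun u hu => (hf u hu).continuousAt.continuousWithinAt)
    (fun u hu => (hf u (interior_subset hu)).differentiableAt.differentiableWithinAt)
    (fun u hu => by
      rw [(hf u (interior_subset hu)).deriv]; exact hm u (interior_subset hu))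
    s (Set.left_mem_Icc.2 hst) t (Set.right_mem_Icc.2 hst) hst
  linarith

/-- barrier lemma -/
lemma barrier {I : Type*} [Finite I] (f f' : I → ℝ → ℝ) (c d : I → ℝ) (t1 T : ℝ) (hT : 0 < T)
    (hder : ∀ i, ∀ t ≥ t1, HasDerivAt (f i) (f' i t) t)
    (hinit : ∀ i, ∀ t ∈ Set.Icc t1 (t1 + T), c i ≤ f i t) (hd : ∀ i, 0 < d i)
    (hstep : ∀ i, ∀ t ≥ t1 + T, (∀ l, ∀ u ∈ Set.Icc t1 t, c l - d l ≤ f l u) → f i t ≤ c i →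
      (-(d i / (2 * T)) ≤ f' i t) ∧ (f i (t - T) ≤ c i → 0 ≤ f' i t)) :
    ∀ i, ∀ t ≥ t1, c i - d i < f i t := by
  by_contra hcon
  push Not at hcon
  obtain ⟨i₁, s₁, hs₁, hs₁'⟩ := hcon
  have hcont : ∀ i, ContinuousOn (f i) (Set.Ici t1) := fun i t ht =>
    (hder i t ht).continuousAt.continuousWithinAt
  let S : Set ℝ := ⋃ i, {t | t ∈ Set.Ici t1 ∧ f i t ≤ c i - d i}
  have hSc : IsClosed S := by
    refine isClosed_iUnion_of_finite fun i => ?_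
    have := (hcont i).preimage_isClosed_of_isClosed isClosed_Ici (isClosed_Iic (a := c i - d i))
    exact this
  have hSne : S.Nonempty := ⟨s₁, Set.mem_iUnion.2 ⟨i₁, hs₁, hs₁'⟩⟩
  have hSb : BddBelow S := ⟨t1, fun t ht => by
    obtain ⟨i, hi⟩ := Set.mem_iUnion.1 ht; exact hi.1⟩
  have hmem := hSc.csInf_mem hSne hSb
  set ts := sInf S with hts
  obtain ⟨i, hti, hfi⟩ := Set.mem_iUnion.1 hmem
  have hti : t1 ≤ ts := hti
  have hbefore : ∀ l, ∀ u, t1 ≤ u → u < ts → c l - d l < f l u := by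
    intro l u hu hut
    by_contra hc
    exact absurd (csInf_le hSb (Set.mem_iUnion.2 ⟨l, hu, not_lt.1 hc⟩)) (not_le.2 hut)
  have hgt : t1 + T < ts := by
    by_contra hc
    have := hinit i ts ⟨hti, not_lt.1 hc⟩
    linarith [hd i]
  have hInv : ∀ l, ∀ u ∈ Set.Icc t1 ts, c l - d l ≤ f l u := by
    intro l u hu
    rcases hu.2.lt_or_eq with h | h
    · exact (hbefore l u hu.1 h).le
    · subst h
      have hcl : ContinuousAt (f l) ts := (hder l ts hti).continuousAt
      have : Tendsto (f l) (nhdsWithin ts (Set.Iio ts)) (nhds (f l ts)) :=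
        hcl.tendsto.mono_left nhdsWithin_le_nhds
      refine ge_of_tendsto this ?_
      have : ∀ᶠ u in nhdsWithin ts (Set.Iio ts), u ∈ Set.Ioo t1 ts :=
        Ioo_mem_nhdsLT (by linarith)
      filter_upwards [this] with u hu
      exact (hbefore l u hu.1.le hu.2).le
  -- last time at or above c
  let Q : Set ℝ := {t | t ∈ Set.Icc t1 ts ∧ c i ≤ f i t}
  have hQc : IsClosed Q := by
    have := ((hcont i).mono (fun u (hu : u ∈ Set.Icc t1 ts) => hu.1)).preimage_isClosed_of_isClosed
      isClosed_Icc (isClosed_Ici (a := c i))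
    exact this
  have hQne : Q.Nonempty := ⟨t1 + T, ⟨by linarith, hgt.le⟩, hinit i _ ⟨by linarith, le_rfl⟩⟩
  have hQb : BddAbove Q := ⟨ts, fun t ht => ht.1.2⟩
  have h0mem := hQc.csSup_mem hQne hQb
  have h0ge : t1 + T ≤ sSup Q := le_csSup hQb ⟨⟨by linarith, hgt.le⟩, hinit i _ ⟨by linarith, le_rfl⟩⟩
  set t0 := sSup Q with ht0
  have hafter : ∀ u, t0 < u → u ≤ ts → f i u < c i := by
    intro u hu hut
    by_contra hc
    exact absurd (le_csSup hQb (show u ∈ Q from ⟨⟨by linarith, hut⟩, not_lt.1 hc⟩)) (not_le.2 hu)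
  have h0ts : t0 ≤ ts := h0mem.1.2
  have h0lt : t0 < ts := by
    rcases h0ts.lt_or_eq with h | h
    · exact h
    · have := h0mem.2; rw [h] at this; linarith [hd i]
  have h0le : f i t0 ≤ c i := by
    have hcl : ContinuousAt (f i) t0 := (hder i t0 (by linarith)).continuousAt
    have : Tendsto (f i) (nhdsWithin t0 (Set.Ioi t0)) (nhds (f i t0)) :=
      hcl.tendsto.mono_left nhdsWithin_le_nhds
    refine le_of_tendsto this ?_
    filter_upwards [Ioo_mem_nhdsGT h0lt] with u hu
    exact (hafter u hu.1 hu.2.le).le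
  have hle : ∀ u ∈ Set.Icc t0 ts, f i u ≤ c i := by
    intro u hu
    rcases hu.1.lt_or_eq with h | h
    · exact (hafter u h hu.2).le
    · rw [← h]; exact h0le
  have hst : ∀ u ∈ Set.Icc t0 ts, (-(d i / (2 * T)) ≤ f' i u) ∧ (f i (u - T) ≤ c i → 0 ≤ f' i u) :=
    fun u hu => hstep i u (by linarith [hu.1])
      (fun l v hv => hInv l v ⟨hv.1, hv.2.trans hu.2⟩) (hle u hu)
  -- first part
  have hmid : ∀ s, t0 ≤ s → s ≤ ts → s ≤ t0 + T → c i - d i / 2 ≤ f i s := by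
    intro s hs1 hs2 hs3
    have := mvt_lower (f := f i) (f' := f' i) (m := -(d i / (2 * T))) hs1
      (fun u hu => hder i u (by linarith [hu.1])) (fun u hu => (hst u ⟨hu.1, hu.2.trans hs2⟩).1)
    have h2 : d i / (2 * T) * (s - t0) ≤ d i / (2 * T) * T :=
      mul_le_mul_of_nonneg_left (by linarith) (by have := hd i; positivity)
    have h3 : d i / (2 * T) * T = d i / 2 := by field_simp
    have := h0mem.2
    linarith
  have hfin : c i - d i / 2 ≤ f i ts := by
    by_cases h : ts ≤ t0 + T
    · exact hmid ts h0ts le_rfl h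
    · push Not at h
      have h1 := hmid (t0 + T) (by linarith) h.le le_rfl
      have := mvt_lower (f := f i) (f' := f' i) (m := 0) h.le
        (fun u hu => hder i u (by linarith [hu.1]))
        (fun u hu => (hst u ⟨by linarith [hu.1], hu.2⟩).2
          (hle _ ⟨by linarith [hu.1], by linarith [hu.2]⟩))
      linarith
  linarith [hd i]

def mon {J : Type*} [Fintype J] (x : J → ℝ) (y : J → ℕ) : ℝ := ∏ j, x j ^ y j

lemma mon_pos {J : Type*} [Fintype J] {x : J → ℝ} (hx : ∀ j, 0 < x j) (y : J → ℕ) :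
    0 < mon x y := Finset.prod_pos fun j _ => pow_pos (hx j) _

lemma mon_mono {J : Type*} [Fintype J] {x x' : J → ℝ} (hx : ∀ j, 0 < x j)
    (h : ∀ j, x j ≤ x' j) (y : J → ℕ) : mon x y ≤ mon x' y :=
  Finset.prod_le_prod (fun j _ => (pow_pos (hx j) _).le)
    fun j _ => pow_le_pow_left₀ (hx j).le (h j) _

lemma mon_eq_exp {J : Type*} [Fintype J] {x : J → ℝ} (hx : ∀ j, 0 < x j) (y : J → ℕ) :
    mon x y = Real.exp (∑ j, (y j : ℝ) * Real.log (x j)) := by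
  rw [Real.exp_sum]
  refine Finset.prod_congr rfl fun j _ => ?_
  rw [← Real.log_pow, Real.exp_log (pow_pos (hx j) _)]

lemma mon_ratio {J : Type*} [Fintype J] {x : J → ℝ} (hx : ∀ j, 0 < x j) (y y' : J → ℕ) (B : ℝ)
    (h : ∑ j, ((y j : ℝ) - y' j) * Real.log (x j) ≤ B) :
    mon x y ≤ Real.exp B * mon x y' := by
  rw [mon_eq_exp hx, mon_eq_exp hx, ← Real.exp_add, Real.exp_le_exp]
  simp only [sub_mul, Finset.sum_sub_distrib] at h
  linarith

/-- the weak reversibility property used -/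
def WR {J ι : Type*} [Fintype J] (y y' : ι → J → ℕ) (V : Submodule ℝ (J → ℝ)) : Prop :=
  ∀ (lam : J → ℝ) (i : ι), (∑ j, lam j * (y' i j : ℝ) < ∑ j, lam j * (y i j : ℝ)) →
    ∃ i', (∑ j, lam j * (y i' j : ℝ) < ∑ j, lam j * (y i j : ℝ)) ∧
      (∑ j, lam j * (y i j : ℝ) ≤ ∑ j, lam j * (y' i' j : ℝ)) ∧
      (fun j => (y i j : ℝ) - y i' j) ∈ V

lemma dominance {J ι : Type*} [Fintype J] [Fintype ι] (y y' : ι → J → ℕ)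
    (V : Submodule ℝ (J → ℝ)) (hWR : WR y y' V) (lam : J → ℝ) (m M : ℝ) (hm : 0 < m) (hM : m ≤ M) :
    ∃ ε0 > (0:ℝ), ∃ C0 ≥ (0:ℝ), ∀ (κ : ι → ℝ) (x xh : J → ℝ) (ε P : ℝ),
      (∀ i, m ≤ κ i ∧ κ i ≤ M) → (∀ j, 0 < x j) → (∀ j, x j ≤ xh j) → 0 ≤ ε → ε ≤ ε0 → 0 ≤ P →
      (∀ i i', (fun j => (y i j : ℝ) - y i' j) ∈ V →
        0 < ∑ j, lam j * ((y i j : ℝ) - y i' j) → mon xh (y i) ≤ ε * mon xh (y i')) →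
      (∀ i, mon xh (y i) ≤ mon x (y i) ∨ mon xh (y i) ≤ P) →
      -(C0 * ε * P) ≤ ∑ i, κ i * mon x (y i) * ∑ j, lam j * ((y' i j : ℝ) - y i j) := by
  classical
  set a : ι → ℝ := fun i => ∑ j, lam j * ((y' i j : ℝ) - y i j) with ha
  obtain ⟨δ, hδ, hδa⟩ : ∃ δ > (0:ℝ), ∀ i, 0 < a i → δ ≤ a i := by
    have : ∀ᶠ δ in nhdsWithin (0:ℝ) (Set.Ioi 0), ∀ i, 0 < a i → δ ≤ a i := by
      rw [eventually_all]
      intro i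
      by_cases h : 0 < a i
      · filter_upwards [Ioo_mem_nhdsGT h] with δ hδ _ using hδ.2.le
      · exact Eventually.of_forall fun δ h' => absurd h' h
    obtain ⟨δ, h1, h2⟩ := (this.and self_mem_nhdsWithin).exists
    exact ⟨δ, h2, h1⟩
  set L : ℝ := ∑ i, |a i| with hL
  have hL0 : 0 ≤ L := Finset.sum_nonneg fun i _ => abs_nonneg _
  have hLa : ∀ i, |a i| ≤ L := fun i =>
    Finset.single_le_sum (f := fun i => |a i|) (fun i _ => abs_nonneg _) (Finset.mem_univ i)
  set r : ℝ := (Fintype.card ι : ℝ) with hr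
  have hr0 : 0 ≤ r := Nat.cast_nonneg _
  have hM0 : 0 < M := hm.trans_le hM
  have hD : 0 < r * M * L + 1 := by positivity
  refine ⟨m * δ / (r * M * L + 1), by positivity, r * M * L, by positivity, ?_⟩
  intro κ x xh ε P hκ hx hxh hε hε0 hP hdom hdich
  set Tm : ι → ℝ := fun i => κ i * mon x (y i) * a i with hTm
  set G : ℝ := ∑ i, max (Tm i) 0 with hG
  have hG0 : 0 ≤ G := Finset.sum_nonneg fun i _ => le_max_right _ _
  have hxh0 : ∀ j, 0 < xh j := fun j => (hx j).trans_le (hxh j)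
  have hkey : ∀ i, -(M * L * ε / (m * δ) * G + M * L * ε * P) ≤ min (Tm i) 0 := by
    intro i
    have hpos1 : 0 ≤ M * L * ε / (m * δ) * G := by positivity
    have hpos2 : 0 ≤ M * L * ε * P := by positivity
    rcases le_or_gt 0 (a i) with hai | hai
    · have : 0 ≤ Tm i := mul_nonneg (mul_nonneg (hm.le.trans (hκ i).1) (mon_pos hx _).le) hai
      rw [min_eq_right this]; linarith
    · have hlt : ∑ j, lam j * (y' i j : ℝ) < ∑ j, lam j * (y i j : ℝ) := by
        simp only [ha, mul_sub, Finset.sum_sub_distrib] at hai; linarith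
      obtain ⟨i', h1, h2, h3⟩ := hWR lam i hlt
      have hd := hdom i i' h3 (by simp only [mul_sub, Finset.sum_sub_distrib]; linarith)
      have hai' : 0 < a i' := by simp only [ha, mul_sub, Finset.sum_sub_distrib]; linarith
      have hxm : mon x (y i) ≤ ε * mon xh (y i') := (mon_mono hx hxh _).trans hd
      have hT : -(M * L * (ε * mon xh (y i'))) ≤ Tm i := by
        have h4 : κ i * mon x (y i) * |a i| ≤ M * (ε * mon xh (y i')) * L := by
          refine mul_le_mul (mul_le_mul (hκ i).2 hxm (mon_pos hx _).le hM0.le) (hLa i)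
            (abs_nonneg _) ?_
          have := mon_pos hxh0 (y i'); positivity
        rw [abs_of_neg hai] at h4
        simp only [hTm]; nlinarith
      have hT0 : Tm i ≤ 0 := mul_nonpos_of_nonneg_of_nonpos
        (mul_nonneg (hm.le.trans (hκ i).1) (mon_pos hx _).le) hai.le
      rw [min_eq_left hT0]
      rcases hdich i' with h | h
      · have hTi' : m * δ * mon x (y i') ≤ Tm i' := by
          have : m * mon x (y i') * δ ≤ κ i' * mon x (y i') * a i' :=
            mul_le_mul (mul_le_mul_of_nonneg_right (hκ i').1 (mon_pos hx _).le) (hδa i' hai')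
              hδ.le (mul_nonneg (hm.le.trans (hκ i').1) (mon_pos hx _).le)
          simp only [hTm]; linarith
        have hGi : Tm i' ≤ G := (le_max_left _ _).trans
          (Finset.single_le_sum (f := fun i => max (Tm i) 0) (fun i _ => le_max_right _ _)
            (Finset.mem_univ i'))
        have : mon xh (y i') ≤ G / (m * δ) := by
          rw [le_div_iff₀ (by positivity)]
          have h7 := mul_le_mul_of_nonneg_left h (mul_pos hm hδ).le
          linarith
        have h5 : M * L * (ε * mon xh (y i')) ≤ M * L * (ε * (G / (m * δ))) := by gcongr
        have h6 : M * L * (ε * (G / (m * δ))) = M * L * ε / (m * δ) * G := by ring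
        linarith
      · have h5 : M * L * (ε * mon xh (y i')) ≤ M * L * (ε * P) := by gcongr
        have h6 : M * L * (ε * P) = M * L * ε * P := by ring
        linarith
  have hsum : ∑ i, Tm i = G + ∑ i, min (Tm i) 0 := by
    rw [hG, ← Finset.sum_add_distrib]
    exact Finset.sum_congr rfl fun i _ => by rw [max_add_min, add_zero]
  have hmin : -(r * (M * L * ε / (m * δ) * G + M * L * ε * P)) ≤ ∑ i, min (Tm i) 0 := by
    have := Finset.card_nsmul_le_sum Finset.univ (fun i => min (Tm i) 0) _ (fun i _ => hkey i)
    rw [nsmul_eq_mul, Finset.card_univ] at this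
    linarith
  have hfrac : r * (M * L * ε / (m * δ)) ≤ 1 := by
    have h1 : ε * (r * M * L + 1) ≤ m * δ := by rwa [le_div_iff₀ hD] at hε0
    have h2 : r * (M * L * ε / (m * δ)) = (r * M * L * ε) / (m * δ) := by ring
    rw [h2, div_le_one (by positivity)]
    nlinarith
  have : r * (M * L * ε / (m * δ)) * G ≤ 1 * G := mul_le_mul_of_nonneg_right hfrac hG0
  change -(r * M * L * ε * P) ≤ ∑ i, Tm i
  rw [hsum]
  nlinarith


lemma logb_pos {g xh η Cc : ℝ} {e : ℕ} (hη : 0 < η) (hC : 0 < Cc) (hg : 0 ≤ g) (hx : 0 < xh)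
    (h : xh ≤ Cc * η ^ e) : g * Real.log xh ≤ e * g * Real.log η + |g| * |Real.log Cc| := by
  have h1 : Real.log xh ≤ Real.log Cc + e * Real.log η := by
    rw [← Real.log_pow, ← Real.log_mul hC.ne' (pow_pos hη _).ne']
    exact Real.log_le_log hx h
  have h2 := mul_le_mul_of_nonneg_left (h1.trans (add_le_add_left (le_abs_self _) _)) hg
  rw [abs_of_nonneg hg]; linarith

lemma logb_neg {g xh η c : ℝ} {e : ℕ} (hη : 0 < η) (hc : 0 < c) (hg : g ≤ 0)
    (h : c * η ^ e ≤ xh) : g * Real.log xh ≤ e * g * Real.log η + |g| * |Real.log c| := by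
  have h1 : Real.log c + e * Real.log η ≤ Real.log xh := by
    rw [← Real.log_pow, ← Real.log_mul hc.ne' (pow_pos hη _).ne']
    exact Real.log_le_log (by positivity) h
  have h2 := mul_le_mul_of_nonpos_left
    ((add_le_add_left (neg_abs_le (Real.log c)) (e * Real.log η)).trans h1) hg
  rw [abs_of_nonpos hg]; linarith

lemma side {J ι : Type*} [Fintype J] [Fintype ι] [DecidableEq J] (y y' : ι → J → ℕ)
    (V : Submodule ℝ (J → ℝ)) (hWR : WR y y' V) (lam : J → ℝ) (m M : ℝ) (hm : 0 < m) (hM : m ≤ M)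
    (L H : Finset J) (hLH : Disjoint L H) (eu el e0 : ℕ) (c Cc : ℝ) (hc : 0 < c) (hcC : c ≤ Cc)
    (hnum : ∀ i i', (fun j => (y i j : ℝ) - y i' j) ∈ V →
        0 < ∑ j, lam j * ((y i j : ℝ) - y i' j) →
        1 ≤ ∑ j ∈ L, min (eu * ((y i j : ℝ) - y i' j)) (el * ((y i j : ℝ) - y i' j))
          + e0 * ∑ j ∈ H, ((y i j : ℝ) - y i' j)) :
    ∃ η0 > (0:ℝ), ∃ K ≥ (0:ℝ), ∀ (η : ℝ) (κ : ι → ℝ) (x xh : J → ℝ) (P : ℝ), 0 < η → η ≤ η0 →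
      (∀ i, m ≤ κ i ∧ κ i ≤ M) → (∀ j, 0 < x j) → (∀ j, x j ≤ xh j) → 0 ≤ P →
      (∀ j ∈ L, xh j ≤ Cc * η ^ eu) →
      ((∀ j ∈ L, c * η ^ el ≤ xh j) ∨ (∀ i i', (fun j => (y i j : ℝ) - y i' j) ∈ V →
        0 < ∑ j, lam j * ((y i j : ℝ) - y i' j) → ∀ j ∈ L, 0 ≤ (y i j : ℝ) - y i' j)) →
      (∀ j ∈ H, c * η ^ e0 ≤ xh j ∧ xh j ≤ Cc * η ^ e0) →
      (∀ j, j ∉ L → j ∉ H → c ≤ xh j ∧ xh j ≤ Cc) →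
      (∀ i, mon xh (y i) ≤ mon x (y i) ∨ mon xh (y i) ≤ P) →
      -(K * η * P) ≤ ∑ i, κ i * mon x (y i) * ∑ j, lam j * ((y' i j : ℝ) - y i j) := by
  obtain ⟨ε0, hε0, C0, hC0, hdom⟩ := dominance y y' V hWR lam m M hm hM
  set Q : ℝ := |Real.log c| + |Real.log Cc| with hQ
  have hQ0 : 0 ≤ Q := by positivity
  set B : ℝ := (∑ i, ∑ i', ∑ j, |(y i j : ℝ) - y i' j|) * Q with hB
  have hCc : 0 < Cc := hc.trans_le hcC
  refine ⟨min 1 (ε0 / Real.exp B), by positivity, C0 * Real.exp B, by positivity, ?_⟩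
  intro η κ x xh P hη hη0 hκ hx hxh hP hLu hLl hH hO hdich
  have hη1 : η ≤ 1 := hη0.trans (min_le_left _ _)
  have hηε : Real.exp B * η ≤ ε0 := by
    have := hη0.trans (min_le_right _ _)
    rw [le_div_iff₀ (Real.exp_pos _)] at this; linarith
  have hlog : Real.log η ≤ 0 := Real.log_nonpos hη.le hη1
  have hxh0 : ∀ j, 0 < xh j := fun j => (hx j).trans_le (hxh j)
  have := hdom κ x xh (Real.exp B * η) P hκ hx hxh (by positivity) hηε hP ?_ hdich
  · refine le_trans (le_of_eq ?_) this
    ring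
  intro i i' hV hpos
  have hn := hnum i i' hV hpos
  have hLl' : ∀ j ∈ L, c * η ^ el ≤ xh j ∨ 0 ≤ (y i j : ℝ) - y i' j := by
    intro j hj
    rcases hLl with h | h
    · exact Or.inl (h j hj)
    · exact Or.inr (h i i' hV hpos j hj)
  have hBi : (∑ j, |(y i j : ℝ) - y i' j|) * Q ≤ B := by
    refine mul_le_mul_of_nonneg_right ?_ hQ0
    refine le_trans ?_ (Finset.single_le_sum (f := fun i => ∑ i', ∑ j, |(y i j : ℝ) - y i' j|)
      (fun i _ => by positivity) (Finset.mem_univ i))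
    exact (Finset.single_le_sum (f := fun i' => ∑ j, |(y i j : ℝ) - y i' j|)
      (fun i _ => by positivity) (Finset.mem_univ i'))
  set g : J → ℝ := fun j => (y i j : ℝ) - y i' j with hg
  have hterm : ∀ j, g j * Real.log (xh j) ≤
      ((if j ∈ L then min (eu * g j) (el * g j) else 0) + (if j ∈ H then e0 * g j else 0))
        * Real.log η + |g j| * Q := by
    intro j
    have hq1 : |g j| * |Real.log Cc| ≤ |g j| * Q :=
      mul_le_mul_of_nonneg_left (by rw [hQ]; linarith [abs_nonneg (Real.log c)]) (abs_nonneg _)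
    have hq2 : |g j| * |Real.log c| ≤ |g j| * Q :=
      mul_le_mul_of_nonneg_left (by rw [hQ]; linarith [abs_nonneg (Real.log Cc)]) (abs_nonneg _)
    by_cases hjL : j ∈ L
    · have hjH : j ∉ H := Finset.disjoint_left.1 hLH hjL
      simp only [hjL, hjH, if_true, if_false, add_zero]
      by_cases hgj : 0 ≤ g j
      · have h1 := logb_pos hη hCc hgj (hxh0 j) (hLu j hjL)
        have h2 := mul_le_mul_of_nonpos_right (min_le_left (eu * g j) (el * g j)) hlog
        linarith
      · have h1 := logb_neg hη hc (not_le.1 hgj).le ((hLl' j hjL).resolve_right hgj)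
        have h2 := mul_le_mul_of_nonpos_right (min_le_right (eu * g j) (el * g j)) hlog
        linarith
    · by_cases hjH : j ∈ H
      · simp only [hjL, hjH, if_true, if_false, zero_add]
        rcases le_total 0 (g j) with hgj | hgj
        · have h1 := logb_pos hη hCc hgj (hxh0 j) (hH j hjH).2
          linarith
        · have h1 := logb_neg hη hc hgj (hH j hjH).1
          linarith
      · simp only [hjL, hjH, if_false, zero_add, zero_mul]
        obtain ⟨h1, h2⟩ := hO j hjL hjH
        rcases le_total 0 (g j) with hgj | hgj
        · have h1 := logb_pos (e := 0) hη hCc hgj (hxh0 j) (by simpa using h2)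
          simp at h1; linarith
        · have h1 := logb_neg (e := 0) hη hc hgj (by simpa using h1)
          simp at h1; linarith
  have hsum := Finset.sum_le_sum (s := Finset.univ) (fun j _ => hterm j)
  rw [Finset.sum_add_distrib, ← Finset.sum_mul, ← Finset.sum_mul, Finset.sum_add_distrib,
    Finset.sum_ite_mem, Finset.sum_ite_mem, Finset.univ_inter, Finset.univ_inter,
    ← Finset.mul_sum] at hsum
  have hfin : ∑ j, g j * Real.log (xh j) ≤ Real.log η + B := by
    have := mul_le_mul_of_nonpos_right hn hlog
    linarith
  have := mon_ratio hxh0 (y i) (y i') (Real.log η + B) hfin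
  rw [Real.exp_add, Real.exp_log hη] at this
  linarith


lemma linalg {J : Type*} [Fintype J] (V : Submodule ℝ (J → ℝ)) (hV : Module.finrank ℝ V ≤ 2)
    (A : Finset J) (hA : A.Nonempty) (z0 : J → ℝ) (hz0 : z0 ∈ V) (hpos : ∀ j ∈ A, 0 < z0 j) :
    (∃ a ∈ A, ∃ c : J → ℝ, (∀ j ∈ A, 0 < c j) ∧ ∀ Y ∈ V, ∀ j ∈ A, Y j = c j * Y a) ∨
    (∃ a ∈ A, ∃ b ∈ A, ∃ α β : J → ℝ, (∀ j ∈ A, 0 ≤ α j ∧ 0 ≤ β j ∧ 0 < α j + β j) ∧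
      α a = 1 ∧ β a = 0 ∧ α b = 0 ∧ β b = 1 ∧ ∀ Y ∈ V, ∀ j ∈ A, Y j = α j * Y a + β j * Y b) := by
  obtain ⟨w, hw⟩ : ∃ w : J → ℝ, ∀ Y ∈ V, ∃ s t : ℝ, Y = s • z0 + t • w := by
    by_cases h : ∃ w ∈ V, w ∉ Submodule.span ℝ {z0}
    · obtain ⟨w, hwV, hw⟩ := h
      refine ⟨w, fun Y hY => ?_⟩
      have hz : z0 ≠ 0 := by
        obtain ⟨a, ha⟩ := hA
        intro h0; have := hpos a ha; rw [h0] at this; simp at this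
      have hli : LinearIndependent ℝ ![z0, w] := by
        rw [LinearIndependent.pair_iff' hz]
        intro s hs
        exact hw (Submodule.mem_span_singleton.2 ⟨s, hs⟩)
      have hfr := finrank_span_eq_card hli
      simp only [Fintype.card_fin] at hfr
      have hr : Set.range ![z0, w] = {z0, w} := by simp [Matrix.range_cons]; exact Set.pair_comm _ _
      have hle : Submodule.span ℝ (Set.range ![z0, w]) ≤ V := by
        rw [Submodule.span_le, hr]
        rintro v (rfl | rfl) <;> assumption
      have heq := Submodule.eq_of_le_of_finrank_le hle (by omega)
      rw [← heq, hr, Submodule.mem_span_pair] at hY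
      obtain ⟨s, t, h⟩ := hY
      exact ⟨s, t, h.symm⟩
    · push Not at h
      refine ⟨0, fun Y hY => ?_⟩
      obtain ⟨s, hs⟩ := Submodule.mem_span_singleton.1 (h Y hY)
      exact ⟨s, 0, by simp [hs]⟩
  set ρ : J → ℝ := fun j => w j / z0 j with hρ
  have hwρ : ∀ j ∈ A, w j = ρ j * z0 j := fun j hj => by
    simp only [hρ]; rw [div_mul_cancel₀]; exact (hpos j hj).ne'
  obtain ⟨a, ha, hamin⟩ := A.exists_min_image ρ hA
  obtain ⟨b, hb, hbmax⟩ := A.exists_max_image ρ hA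
  have hza := hpos a ha
  have hzb := hpos b hb
  rcases (hamin b hb).lt_or_eq with hlt | heq
  · right
    have hd : 0 < ρ b - ρ a := by linarith
    refine ⟨a, ha, b, hb, fun j => z0 j / z0 a * ((ρ b - ρ j) / (ρ b - ρ a)),
      fun j => z0 j / z0 b * ((ρ j - ρ a) / (ρ b - ρ a)), ?_, ?_, ?_, ?_, ?_, ?_⟩
    · intro j hj
      have hzj := hpos j hj
      have h1 := hamin j hj
      have h2 := hbmax j hj
      have hα : 0 ≤ z0 j / z0 a * ((ρ b - ρ j) / (ρ b - ρ a)) :=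
        mul_nonneg (by positivity) (div_nonneg (by linarith) hd.le)
      have hβ : 0 ≤ z0 j / z0 b * ((ρ j - ρ a) / (ρ b - ρ a)) :=
        mul_nonneg (by positivity) (div_nonneg (by linarith) hd.le)
      refine ⟨hα, hβ, ?_⟩
      rcases h1.lt_or_eq with h | h
      · have : 0 < z0 j / z0 b * ((ρ j - ρ a) / (ρ b - ρ a)) :=
          mul_pos (by positivity) (div_pos (by linarith) hd)
        linarith
      · have : 0 < z0 j / z0 a * ((ρ b - ρ j) / (ρ b - ρ a)) :=
          mul_pos (by positivity) (div_pos (by linarith) hd)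
        linarith
    · simp only []; rw [div_self hza.ne', div_self hd.ne', one_mul]
    · simp
    · simp
    · simp only []; rw [div_self hzb.ne', div_self hd.ne', one_mul]
    · intro Y hY j hj
      obtain ⟨s, t, rfl⟩ := hw Y hY
      simp only [Pi.add_apply, Pi.smul_apply, smul_eq_mul, hwρ j hj, hwρ a ha, hwρ b hb]
      generalize ρ a = ra at *
      generalize ρ b = rb at *
      generalize ρ j = rj at *
      have h3 := hd.ne'
      field_simp
      ring
  · left
    refine ⟨a, ha, fun j => z0 j / z0 a, fun j hj => div_pos (hpos j hj) hza, ?_⟩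
    intro Y hY j hj
    obtain ⟨s, t, rfl⟩ := hw Y hY
    have h1 : ρ j = ρ a := le_antisymm ((hbmax j hj).trans heq.ge) (hamin j hj)
    simp only [Pi.add_apply, Pi.smul_apply, smul_eq_mul, hwρ j hj, hwρ a ha, h1]
    field_simp


lemma mon_le_single {J : Type*} [Fintype J] [DecidableEq J] {x : J → ℝ} (hx : ∀ j, 0 < x j)
    {Cc : ℝ} (hC : 1 ≤ Cc) (hxC : ∀ j, x j ≤ Cc) (y : J → ℕ) (j0 : J) (hj0 : y j0 ≠ 0) :
    mon x y ≤ x j0 * Cc ^ (∑ j, y j) := by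
  unfold mon
  rw [← Finset.mul_prod_erase _ _ (Finset.mem_univ j0),
    ← Finset.add_sum_erase _ _ (Finset.mem_univ j0), pow_add, ← mul_assoc]
  refine mul_le_mul ?_ ?_ (Finset.prod_nonneg fun j _ => (pow_pos (hx j) _).le)
    (mul_nonneg (hx j0).le (by positivity))
  · obtain ⟨k, hk⟩ := Nat.exists_eq_succ_of_ne_zero hj0
    rw [hk, pow_succ']
    refine mul_le_mul_of_nonneg_left ?_ (hx j0).le
    calc x j0 ^ k ≤ Cc ^ k := pow_le_pow_left₀ (hx j0).le (hxC j0) _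
      _ ≤ Cc ^ (k.succ) := pow_le_pow_right₀ hC (Nat.le_succ k)
  · rw [← Finset.prod_pow_eq_pow_sum]
    exact Finset.prod_le_prod (fun j _ => (pow_pos (hx j) _).le)
      fun j _ => pow_le_pow_left₀ (hx j).le (hxC j) _

lemma step_gen {J ι : Type*} [Fintype J] [Fintype ι] [DecidableEq J] (y y' : ι → J → ℕ)
    (V : Submodule ℝ (J → ℝ)) (hWR : WR y y' V) (lam : J → ℝ) (m M : ℝ) (hm : 0 < m) (hM : m ≤ M)
    (L H : Finset J) (hLH : Disjoint L H) (eu el e0 : ℕ) (hul : eu ≤ el)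
    (c Cc : ℝ) (hc : 0 < c) (hcC : c ≤ Cc) (hC1 : 1 ≤ Cc)
    (hnum : ∀ i i', (fun j => (y i j : ℝ) - y i' j) ∈ V →
        0 < ∑ j, lam j * ((y i j : ℝ) - y i' j) →
        1 ≤ ∑ j ∈ L, min (eu * ((y i j : ℝ) - y i' j)) (el * ((y i j : ℝ) - y i' j))
          + e0 * ∑ j ∈ H, ((y i j : ℝ) - y i' j)) :
    ∃ η0 > (0:ℝ), ∃ K ≥ (0:ℝ), ∀ (η : ℝ) (κ : ι → ℝ) (x : J → ℝ), 0 < η → η ≤ η0 →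
      (∀ i, m ≤ κ i ∧ κ i ≤ M) → (∀ j, 0 < x j) →
      (∀ j ∈ L, x j ≤ Cc * η ^ eu) →
      (∀ j ∈ H, c * η ^ e0 ≤ x j ∧ x j ≤ Cc * η ^ e0) →
      (∀ j, j ∉ L → j ∉ H → c ≤ x j ∧ x j ≤ Cc) →
      (-(K * η * η ^ el) ≤ ∑ i, κ i * mon x (y i) * ∑ j, lam j * ((y' i j : ℝ) - y i j)) ∧
      ((∀ j ∈ L, c * η ^ el ≤ x j) →
        0 ≤ ∑ i, κ i * mon x (y i) * ∑ j, lam j * ((y' i j : ℝ) - y i j)) ∧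
      ((∀ i i', (fun j => (y i j : ℝ) - y i' j) ∈ V →
        0 < ∑ j, lam j * ((y i j : ℝ) - y i' j) → ∀ j ∈ L, 0 ≤ (y i j : ℝ) - y i' j) →
        0 ≤ ∑ i, κ i * mon x (y i) * ∑ j, lam j * ((y' i j : ℝ) - y i j)) := by
  obtain ⟨η0, hη0, K, hK, hside⟩ := side y y' V hWR lam m M hm hM L H hLH eu el e0 c Cc hc hcC hnum
  set F : ℝ := ∑ i, Cc ^ (∑ j, y i j) with hF
  have hF0 : 0 ≤ F := by positivity
  refine ⟨min 1 η0, by positivity, K * (c * F), by positivity, ?_⟩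
  intro η κ x hη hη' hκ hx hLu hH hO
  have hη1 : η ≤ 1 := hη'.trans (min_le_left _ _)
  have hη2 : η ≤ η0 := hη'.trans (min_le_right _ _)
  refine ⟨?_, ?_, ?_⟩
  · set xh : J → ℝ := fun j => if j ∈ L then max (x j) (c * η ^ el) else x j with hxh
    have hle : ∀ j, x j ≤ xh j := by
      intro j; simp only [hxh]; split_ifs
      · exact le_max_left _ _
      · exact le_rfl
    have hLu' : ∀ j ∈ L, xh j ≤ Cc * η ^ eu := by
      intro j hj
      simp only [hxh, hj, if_true]
      refine max_le (hLu j hj) ?_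
      exact mul_le_mul hcC (pow_le_pow_of_le_one hη.le hη1 hul) (by positivity) (by linarith)
    have hxhC : ∀ j, xh j ≤ Cc := by
      intro j
      by_cases hj : j ∈ L
      · refine (hLu' j hj).trans ?_
        have : η ^ eu ≤ 1 := pow_le_one₀ hη.le hη1
        nlinarith
      · simp only [hxh, hj, if_false]
        by_cases hjH : j ∈ H
        · refine (hH j hjH).2.trans ?_
          have : η ^ e0 ≤ 1 := pow_le_one₀ hη.le hη1
          nlinarith
        · exact (hO j hj hjH).2
    have hHd : ∀ j ∈ H, j ∉ L := fun j hj h => Finset.disjoint_left.1 hLH h hj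
    have := hside η κ x xh (c * η ^ el * F) hη hη2 hκ hx hle (by positivity) hLu'
      (Or.inl fun j hj => by simp only [hxh, hj, if_true]; exact le_max_right _ _)
      (fun j hj => by simp only [hxh, hHd j hj, if_false]; exact hH j hj)
      (fun j hj hj' => by simp only [hxh, hj, if_false]; exact hO j hj hj') ?_
    · refine le_trans (le_of_eq ?_) this
      ring
    · intro i
      by_cases hex : ∃ j, y i j ≠ 0 ∧ xh j ≠ x j
      · right
        obtain ⟨j, hyj, hj⟩ := hex
        have hjL : j ∈ L := by
          by_contra h; exact hj (by simp only [hxh, h, if_false])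
        have hxj : xh j = c * η ^ el := by
          simp only [hxh, hjL, if_true] at hj ⊢
          rcases max_choice (x j) (c * η ^ el) with h | h
          · exact absurd h hj
          · exact h
        have h1 := mon_le_single (fun j => (hx j).trans_le (hle j)) hC1 hxhC (y i) j hyj
        rw [hxj] at h1
        refine h1.trans (mul_le_mul_of_nonneg_left ?_ (by positivity))
        exact Finset.single_le_sum (f := fun i => Cc ^ (∑ j, y i j))
          (fun i _ => by positivity) (Finset.mem_univ i)
      · left
        push Not at hex
        refine le_of_eq (Finset.prod_congr rfl fun j _ => ?_)
        by_cases h : y i j = 0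
        · rw [h, pow_zero, pow_zero]
        · rw [hex j h]
  · intro hl
    have := hside η κ x x 0 hη hη2 hκ hx (fun _ => le_rfl) le_rfl hLu (Or.inl hl) hH hO
      (fun i => Or.inl le_rfl)
    simpa using this
  · intro hl
    have := hside η κ x x 0 hη hη2 hκ hx (fun _ => le_rfl) le_rfl hLu (Or.inr hl) hH hO
      (fun i => Or.inl le_rfl)
    simpa using this


lemma num_wing {J : Type*} [DecidableEq J] (A J1 : Finset J) (hsub : J1 ⊆ A) (g : J → ℤ)
    (D : ℕ) (hD : ∑ j ∈ A, |g j| ≤ D) (hs : (∀ j ∈ J1, 0 ≤ g j) ∨ (∀ j ∈ J1, g j ≤ 0)) (k : ℕ)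
    (hpos : 0 < ((D+1).factorial : ℤ) * ∑ j ∈ A, g j + k * ∑ j ∈ J1, g j) :
    1 ≤ ∑ j ∈ J1, ((2 * ((D+1).factorial : ℤ) + 2 * k) * g j - |g j|)
      + 2 * ((D+1).factorial : ℤ) * ∑ j ∈ A \ J1, g j := by
  set q : ℤ := ((D+1).factorial : ℤ) with hq
  set g1 := ∑ j ∈ J1, g j with hg1
  have habs : ∑ j ∈ J1, |g j| = |g1| := by
    rcases hs with h | h
    · rw [abs_of_nonneg (Finset.sum_nonneg h)]
      exact Finset.sum_congr rfl fun j hj => abs_of_nonneg (h j hj)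
    · rw [abs_of_nonpos (Finset.sum_nonpos h), ← Finset.sum_neg_distrib]
      exact Finset.sum_congr rfl fun j hj => abs_of_nonpos (h j hj)
  have hsplit : ∑ j ∈ A \ J1, g j + g1 = ∑ j ∈ A, g j := Finset.sum_sdiff hsub
  rw [Finset.sum_sub_distrib, ← Finset.mul_sum, habs]
  have hle : |g1| ≤ D := by
    rw [← habs]
    exact (Finset.sum_le_sum_of_subset_of_nonneg hsub fun j _ _ => abs_nonneg _).trans hD
  have hmain : |g1| + 1 ≤ 2 * (q * ∑ j ∈ A, g j + k * g1) := by
    by_cases h0 : g1 = 0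
    · rw [h0] at hpos ⊢; simp at hpos ⊢; linarith
    · have h1 : g1.natAbs ∣ (D+1).factorial := by
        refine Nat.dvd_factorial (Int.natAbs_pos.2 h0) ?_
        have := Int.natCast_natAbs g1
        omega
      have h2 : |g1| ∣ q := by
        rw [hq, ← Int.natCast_natAbs]; exact_mod_cast h1
      have h3 : |g1| ∣ q * ∑ j ∈ A, g j + k * g1 :=
        dvd_add (h2.mul_right _) (((abs_dvd _ _).2 dvd_rfl).mul_left _)
      have h4 := Int.le_of_dvd hpos h3
      have h5 : 1 ≤ |g1| := Int.one_le_abs h0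
      linarith
  have : ∑ j ∈ A \ J1, g j = ∑ j ∈ A, g j - g1 := by linarith
  rw [this]
  linarith

lemma num_sign {J : Type*} [DecidableEq J] (A J1 : Finset J) (hsub : J1 ⊆ A) (g : J → ℤ)
    (D : ℕ) (hD : ∑ j ∈ A, |g j| ≤ D) (hs : (∀ j ∈ J1, 0 ≤ g j) ∨ (∀ j ∈ J1, g j ≤ 0)) (k : ℕ)
    (hk : (D+1).factorial * (D + 1) ≤ k)
    (hpos : 0 < ((D+1).factorial : ℤ) * ∑ j ∈ A, g j + k * ∑ j ∈ J1, g j) :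
    ∀ j ∈ J1, 0 ≤ g j := by
  rcases hs with h | h
  · exact h
  · by_contra hcon
    push Not at hcon
    obtain ⟨j, hj, hlt⟩ := hcon
    have h1 : ∑ j ∈ J1, g j ≤ -1 := by
      have : ∑ j ∈ J1, g j ≤ g j := by
        rw [← Finset.add_sum_erase _ _ hj]
        have := Finset.sum_nonpos (s := J1.erase j) (f := g)
          (fun i hi => h i (Finset.mem_of_mem_erase hi))
        linarith
      linarith
    have h2 : ∑ j ∈ A, g j ≤ D := (Finset.sum_le_sum fun j _ => le_abs_self (g j)).trans hD
    have hk' : ((D+1).factorial : ℤ) * (D + 1) ≤ k := by exact_mod_cast hk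
    have hq : 0 < ((D+1).factorial : ℤ) := by exact_mod_cast Nat.factorial_pos _
    have h3 : (k : ℤ) * ∑ j ∈ J1, g j ≤ k * (-1) := mul_le_mul_of_nonneg_left h1 (by positivity)
    have h4 := mul_le_mul_of_nonneg_left h2 hq.le
    nlinarith

lemma min_eq_form (g E : ℝ) : (E * g - |g|) ≤ min ((E - 1) * g) ((E + 1) * g) := by
  refine le_min ?_ ?_
  · linarith [le_abs_self g]
  · linarith [neg_abs_le g]

lemma lamsum {J : Type*} [Fintype J] [DecidableEq J] (A J1 : Finset J) (q k : ℝ) (g : J → ℝ) :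
    ∑ j, ((if j ∈ A then q else 0) + (if j ∈ J1 then k else 0)) * g j =
      q * ∑ j ∈ A, g j + k * ∑ j ∈ J1, g j := by
  simp only [add_mul, ite_mul, zero_mul, Finset.sum_add_distrib, Finset.sum_ite_mem,
    Finset.univ_inter, Finset.mul_sum]

lemma sign_J1 {J : Type*} (A : Finset J) [DecidableEq J] (a b : J) (α β : J → ℝ)
    (hαβ : ∀ j ∈ A, 0 ≤ α j ∧ 0 ≤ β j ∧ 0 < α j + β j) (J1 : Finset J)
    (hJ1 : ∀ j ∈ J1, j ∈ A ∧ β j = 0) (g : J → ℤ)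
    (hg : ∀ j ∈ A, (g j : ℝ) = α j * g a + β j * g b) :
    (∀ j ∈ J1, 0 ≤ g j) ∨ (∀ j ∈ J1, g j ≤ 0) := by
  rcases le_total 0 (g a) with h | h
  · left; intro j hj
    obtain ⟨hjA, hb⟩ := hJ1 j hj
    have := hg j hjA
    rw [hb, zero_mul, add_zero] at this
    have h' : (0:ℝ) ≤ g a := by exact_mod_cast h
    have : (0:ℝ) ≤ g j := by rw [this]; exact mul_nonneg (hαβ j hjA).1 h'
    exact_mod_cast this
  · right; intro j hj
    obtain ⟨hjA, hb⟩ := hJ1 j hj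
    have := hg j hjA
    rw [hb, zero_mul, add_zero] at this
    have h' : (g a : ℝ) ≤ 0 := by exact_mod_cast h
    have : (g j : ℝ) ≤ 0 := by rw [this]; exact mul_nonpos_of_nonneg_of_nonpos (hαβ j hjA).1 h'
    exact_mod_cast this

lemma num_all {J ι : Type*} [Fintype J] [DecidableEq J] (y : ι → J → ℕ)
    (V : Submodule ℝ (J → ℝ)) (A : Finset J) (a b : J) (α β : J → ℝ)
    (hαβ : ∀ j ∈ A, 0 ≤ α j ∧ 0 ≤ β j ∧ 0 < α j + β j)
    (hlin : ∀ Y ∈ V, ∀ j ∈ A, Y j = α j * Y a + β j * Y b)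
    (D : ℕ) (hD : ∀ i i', ∑ j ∈ A, |(y i j : ℤ) - y i' j| ≤ D)
    (J1 : Finset J) (hJ1 : ∀ j ∈ J1, j ∈ A ∧ β j = 0) (k : ℕ) :
    ∀ i i', (fun j => (y i j : ℝ) - y i' j) ∈ V →
        0 < ∑ j, ((if j ∈ A then ((D+1).factorial : ℝ) else 0) + (if j ∈ J1 then (k : ℝ) else 0)) *
          ((y i j : ℝ) - y i' j) →
      (1 ≤ ∑ j ∈ J1, ((2 * ((D+1).factorial : ℝ) + 2 * k) * ((y i j : ℝ) - y i' j)
          - |(y i j : ℝ) - y i' j|)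
        + 2 * ((D+1).factorial : ℝ) * ∑ j ∈ A \ J1, ((y i j : ℝ) - y i' j)) ∧
      ((D+1).factorial * (D + 1) ≤ k → ∀ j ∈ J1, 0 ≤ (y i j : ℝ) - y i' j) := by
  intro i i' hV hpos
  rw [lamsum A J1 _ _ (fun j => (y i j : ℝ) - y i' j)] at hpos
  set g : J → ℤ := fun j => (y i j : ℤ) - y i' j with hg
  have hgc : ∀ j, (y i j : ℝ) - y i' j = (g j : ℝ) := fun j => by simp [hg]
  have hs := sign_J1 A a b α β hαβ J1 hJ1 g (fun j hj => by
    rw [← hgc, ← hgc, ← hgc]; exact hlin _ hV j hj)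
  simp only [hgc] at hpos ⊢
  have hpos' : 0 < ((D+1).factorial : ℤ) * ∑ j ∈ A, g j + k * ∑ j ∈ J1, g j := by
    exact_mod_cast hpos
  constructor
  · have := num_wing A J1 (fun j hj => (hJ1 j hj).1) g D (hD i i') hs k hpos'
    exact_mod_cast this
  · intro hk j hj
    have := num_sign A J1 (fun j hj => (hJ1 j hj).1) g D (hD i i') hs k hk hpos' j hj
    exact_mod_cast this


lemma exists_low {J : Type*} (s : Finset J) (f : J → ℝ) (hf : ∀ j ∈ s, 0 < f j) :
    ∃ c > (0:ℝ), ∀ j ∈ s, c ≤ f j := by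
  rcases s.eq_empty_or_nonempty with rfl | h
  · exact ⟨1, one_pos, by simp⟩
  · obtain ⟨j, hj, hmin⟩ := s.exists_min_image f h
    exact ⟨f j, hf j hj, hmin⟩

lemma wing {J ι : Type*} [Fintype J] [Fintype ι] [DecidableEq J] (y y' : ι → J → ℕ)
    (V : Submodule ℝ (J → ℝ)) (hWR : WR y y' V) (m M : ℝ) (hm : 0 < m) (hM : m ≤ M)
    (A : Finset J) (a b : J) (ha : a ∈ A) (hb : b ∈ A) (α β : J → ℝ)
    (hαβ : ∀ j ∈ A, 0 ≤ α j ∧ 0 ≤ β j ∧ 0 < α j + β j) (hαa : α a = 1) (hβa : β a = 0)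
    (hβb : β b = 1)
    (hlin : ∀ Y ∈ V, ∀ j ∈ A, Y j = α j * Y a + β j * Y b)
    (D : ℕ) (hD : ∀ i i', ∑ j ∈ A, |(y i j : ℤ) - y i' j| ≤ D)
    (J1 : Finset J) (hJ1 : ∀ j, j ∈ J1 ↔ j ∈ A ∧ β j = 0) (k : ℕ)
    (C cl Cu : ℝ) (hC : 1 ≤ C) (hcl : 0 < cl) (q : ℕ) (hq : q = (D+1).factorial) :
    ∃ η0 > (0:ℝ), ∃ K ≥ (0:ℝ), ∀ (η : ℝ) (κ : ι → ℝ) (x zt zs : J → ℝ), 0 < η → η ≤ η0 →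
      (∀ i, m ≤ κ i ∧ κ i ≤ M) → (∀ j, 0 < x j) → (∀ j ∈ A, x j ≤ zt j) →
      (∀ j ∈ A, zs j ≤ C * x j) → (∀ j ∈ A, 0 < zs j) →
      (∀ j ∈ A, zs j = α j * zs a + β j * zs b) →
      (∀ j, j ∉ A → cl ≤ x j ∧ x j ≤ Cu) →
      (∑ j ∈ J1, zt j ≤ 2 * η ^ (2 * q + 2 * k + 1)) → (∑ j ∈ A, zt j ≤ 2 * η ^ (2 * q)) →
      (η ^ (2 * q) / 2 ≤ ∑ j ∈ A, zs j) →
      (-(K * η * η ^ (2 * q + 2 * (k + 1) + 1)) ≤ ∑ i, κ i * mon x (y i) *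
        ∑ j, ((if j ∈ A then (q : ℝ) else 0) + (if j ∈ J1 then ((k + 1 : ℕ) : ℝ) else 0)) *
          ((y' i j : ℝ) - y i j)) ∧
      (η ^ (2 * q + 2 * (k + 1) + 1) / 2 ≤ ∑ j ∈ J1, zs j → 0 ≤ ∑ i, κ i * mon x (y i) *
        ∑ j, ((if j ∈ A then (q : ℝ) else 0) + (if j ∈ J1 then ((k + 1 : ℕ) : ℝ) else 0)) *
          ((y' i j : ℝ) - y i j)) ∧
      (q * (D + 1) ≤ k + 1 → 0 ≤ ∑ i, κ i * mon x (y i) *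
        ∑ j, ((if j ∈ A then (q : ℝ) else 0) + (if j ∈ J1 then ((k + 1 : ℕ) : ℝ) else 0)) *
          ((y' i j : ℝ) - y i j)) := by
  have hsub : J1 ⊆ A := fun j hj => ((hJ1 j).1 hj).1
  have haJ1 : a ∈ J1 := (hJ1 a).2 ⟨ha, hβa⟩
  set S1 := ∑ j ∈ J1, α j with hS1
  set Sα := ∑ j ∈ A, α j with hSα
  set Sβ := ∑ j ∈ A, β j with hSβ
  have hS1p : 0 < S1 := by
    have := Finset.single_le_sum (f := α) (fun j hj => (hαβ j (hsub hj)).1) haJ1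
    linarith
  have hSαp : 0 < Sα := by
    have := Finset.single_le_sum (f := α) (fun j hj => (hαβ j hj).1) ha
    linarith
  have hSβp : 0 < Sβ := by
    have := Finset.single_le_sum (f := β) (fun j hj => (hαβ j hj).2.1) hb
    linarith
  have hC0 : 0 < C := by linarith
  obtain ⟨c1, hc1, hlow⟩ := exists_low J1 (fun j => α j / (2 * S1 * C)) (fun j hj => by
    have h := hαβ j (hsub hj)
    have h2 := ((hJ1 j).1 hj).2
    have : 0 < α j := by linarith [h.2.2]
    positivity)
  obtain ⟨c2, hc2, hc2'⟩ := exists_low (A \ J1) (fun j => β j / (4 * Sβ * C)) (fun j hj => by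
    rw [Finset.mem_sdiff, hJ1] at hj
    have h := hαβ j hj.1
    have : 0 < β j := lt_of_le_of_ne h.2.1 (fun h' => hj.2 ⟨hj.1, h'.symm⟩)
    positivity)
  set c := min (min c1 c2) (min cl 1) with hc
  have hcp : 0 < c := by positivity
  set Cc := max 2 Cu with hCc
  have hCc2 : 2 ≤ Cc := le_max_left _ _
  have hc1c : c ≤ c1 := (min_le_left _ _).trans (min_le_left _ _)
  have hc2c : c ≤ c2 := (min_le_left _ _).trans (min_le_right _ _)
  have hclc : c ≤ cl := (min_le_right _ _).trans (min_le_left _ _)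
  have hc1' : c ≤ 1 := (min_le_right _ _).trans (min_le_right _ _)
  have hnum := num_all y V A a b α β hαβ hlin D hD J1 (fun j hj => (hJ1 j).1 hj) (k + 1)
  rw [← hq] at hnum
  obtain ⟨η0, hη0, K, hK, hstep⟩ := step_gen y y' V hWR
    (fun j => (if j ∈ A then (q : ℝ) else 0) + (if j ∈ J1 then ((k + 1 : ℕ) : ℝ) else 0))
    m M hm hM J1 (A \ J1) Finset.disjoint_sdiff (2 * q + 2 * k + 1) (2 * q + 2 * (k + 1) + 1)
    (2 * q) (by omega) c Cc hcp (by linarith) (by linarith) (by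
      intro i i' hV hpos
      refine (hnum i i' hV hpos).1.trans ?_
      push_cast
      refine add_le_add (Finset.sum_le_sum fun j _ => ?_) le_rfl
      refine (min_eq_form _ _).trans (le_of_eq ?_)
      congr 1 <;> ring)
  refine ⟨min (min 1 η0) (1 / (8 * C * Sα)), by positivity, K, hK, ?_⟩
  intro η κ x zt zs hη hη' hκ hx hxz hzx hzs hzl hO hN1 hN hNs
  have hη1 : η ≤ 1 := hη'.trans ((min_le_left _ _).trans (min_le_left _ _))
  have hη2 : η ≤ η0 := hη'.trans ((min_le_left _ _).trans (min_le_right _ _))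
  have hη3 : η ≤ 1 / (8 * C * Sα) := hη'.trans (min_le_right _ _)
  set h := η ^ (2 * q) with hh
  have hhp : 0 < h := by positivity
  have hzt : ∀ j ∈ A, 0 < zt j := fun j hj => (hx j).trans_le (hxz j hj)
  have hLu : ∀ j ∈ J1, x j ≤ Cc * η ^ (2 * q + 2 * k + 1) := by
    intro j hj
    have h1 := Finset.single_le_sum (f := zt) (fun j hj => (hzt j (hsub hj)).le) hj
    have h2 : 2 * η ^ (2 * q + 2 * k + 1) ≤ Cc * η ^ (2 * q + 2 * k + 1) := by gcongr
    linarith [hxz j (hsub hj)]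
  have hzsa : zs a ≤ 2 * C * (η * h) := by
    have h1 := hzx a ha
    have h2 : x a ≤ 2 * η ^ (2 * q + 2 * k + 1) := by
      have h1 := Finset.single_le_sum (f := zt) (fun j hj => (hzt j (hsub hj)).le) haJ1
      linarith [hxz a ha]
    have h3 : η ^ (2 * q + 2 * k + 1) ≤ η ^ (2 * q + 1) :=
      pow_le_pow_of_le_one hη.le hη1 (by omega)
    have h4 : η ^ (2 * q + 1) = η * h := by rw [pow_succ]; ring
    have h5 : C * x a ≤ C * (2 * (η * h)) := by gcongr; linarith
    linarith
  have hsumA : ∑ j ∈ A, zs j = Sα * zs a + Sβ * zs b := by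
    rw [hSα, hSβ, Finset.sum_mul, Finset.sum_mul, ← Finset.sum_add_distrib]
    exact Finset.sum_congr rfl hzl
  have hsmall : Sα * zs a ≤ h / 4 := by
    have h1 : η * (8 * C * Sα) ≤ 1 := by rwa [le_div_iff₀ (by positivity)] at hη3
    have h2 : Sα * zs a ≤ Sα * (2 * C * (η * h)) := by gcongr
    have h3 := mul_le_mul_of_nonneg_right h1 hhp.le
    nlinarith
  have hzsb : h / (4 * Sβ) ≤ zs b := by
    rw [div_le_iff₀ (by positivity)]
    linarith
  have hH : ∀ j ∈ A \ J1, c * h ≤ x j ∧ x j ≤ Cc * h := by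
    intro j hj
    have hjA := (Finset.mem_sdiff.1 hj).1
    constructor
    · have h1 : β j * zs b ≤ zs j := by
        rw [hzl j hjA]
        have := mul_nonneg (hαβ j hjA).1 (hzs a ha).le
        linarith
      have h2 : β j * (h / (4 * Sβ)) ≤ C * x j :=
        (mul_le_mul_of_nonneg_left hzsb (hαβ j hjA).2.1).trans (h1.trans (hzx j hjA))
      have h3 : c * h ≤ β j / (4 * Sβ * C) * h :=
        mul_le_mul_of_nonneg_right (hc2c.trans (hc2' j hj)) hhp.le
      have h4 : β j / (4 * Sβ * C) * h = β j * (h / (4 * Sβ)) / C := by field_simp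
      rw [h4] at h3
      refine h3.trans ?_
      rw [div_le_iff₀ hC0]; linarith
    · have h1 := Finset.single_le_sum (f := zt) (fun j hj => (hzt j hj).le) hjA
      have h2 : 2 * h ≤ Cc * h := by gcongr
      linarith [hxz j hjA]
  have hO' : ∀ j, j ∉ J1 → j ∉ A \ J1 → c ≤ x j ∧ x j ≤ Cc := by
    intro j hj1 hj2
    have hjA : j ∉ A := fun h => hj2 (Finset.mem_sdiff.2 ⟨h, hj1⟩)
    exact ⟨hclc.trans (hO j hjA).1, (hO j hjA).2.trans (le_max_right _ _)⟩
  obtain ⟨r1, r2, r3⟩ := hstep η κ x hη hη2 hκ hx hLu hH hO'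
  refine ⟨r1, fun hl => r2 ?_, fun hk => r3 fun i i' hV hpos => (hnum i i' hV hpos).2 hk⟩
  intro j hj
  have hjA := hsub hj
  have hbj := ((hJ1 j).1 hj).2
  have hsum1 : ∑ j ∈ J1, zs j = S1 * zs a := by
    rw [hS1, Finset.sum_mul]
    refine Finset.sum_congr rfl fun j hj => ?_
    rw [hzl j (hsub hj), ((hJ1 j).1 hj).2]; ring
  rw [hsum1] at hl
  set e := η ^ (2 * q + 2 * (k + 1) + 1) with he
  have hep : 0 < e := by positivity
  have h0 : e / (2 * S1) ≤ zs a := by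
    rw [div_le_iff₀ (by positivity)]; linarith
  have h1 : zs j = α j * zs a := by rw [hzl j hjA, hbj]; ring
  have h2 : α j * (e / (2 * S1)) ≤ C * x j :=
    (mul_le_mul_of_nonneg_left h0 (hαβ j hjA).1).trans (h1.symm.le.trans (hzx j hjA))

  have h3 : c * e ≤ α j / (2 * S1 * C) * e :=
    mul_le_mul_of_nonneg_right (hc1c.trans (hlow j hj)) hep.le
  have h4 : α j / (2 * S1 * C) * e = α j * (e / (2 * S1)) / C := by field_simp
  rw [h4] at h3
  refine h3.trans ?_
  rw [div_le_iff₀ hC0]; linarith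


lemma low_J1 {J : Type*} [DecidableEq J] (A : Finset J) (a b : J) (ha : a ∈ A) (α β : J → ℝ)
    (hαβ : ∀ j ∈ A, 0 ≤ α j ∧ 0 ≤ β j ∧ 0 < α j + β j) (hαa : α a = 1) (hβa : β a = 0)
    (J1 : Finset J) (hJ1 : ∀ j, j ∈ J1 ↔ j ∈ A ∧ β j = 0) (C : ℝ) (hC : 1 ≤ C) :
    ∃ c > (0:ℝ), ∀ (x zs : J → ℝ) (e : ℝ), 0 < e → (∀ j ∈ A, zs j ≤ C * x j) →
      (∀ j ∈ A, zs j = α j * zs a + β j * zs b) → e / 2 ≤ ∑ j ∈ J1, zs j →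
      ∀ j ∈ J1, c * e ≤ x j := by
  have hsub : J1 ⊆ A := fun j hj => ((hJ1 j).1 hj).1
  have haJ1 : a ∈ J1 := (hJ1 a).2 ⟨ha, hβa⟩
  set S1 := ∑ j ∈ J1, α j with hS1
  have hS1p : 0 < S1 := by
    have := Finset.single_le_sum (f := α) (fun j hj => (hαβ j (hsub hj)).1) haJ1
    linarith
  have hC0 : 0 < C := by linarith
  obtain ⟨c1, hc1, hlow⟩ := exists_low J1 (fun j => α j / (2 * S1 * C)) (fun j hj => by
    have h := hαβ j (hsub hj)
    have h2 := ((hJ1 j).1 hj).2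
    have : 0 < α j := by linarith [h.2.2]
    positivity)
  refine ⟨c1, hc1, ?_⟩
  intro x zs e hep hzx hzl hl j hj
  have hjA := hsub hj
  have hbj := ((hJ1 j).1 hj).2
  have hsum1 : ∑ j ∈ J1, zs j = S1 * zs a := by
    rw [hS1, Finset.sum_mul]
    refine Finset.sum_congr rfl fun j hj => ?_
    rw [hzl j (hsub hj), ((hJ1 j).1 hj).2]; ring
  rw [hsum1] at hl
  have h0 : e / (2 * S1) ≤ zs a := by
    rw [div_le_iff₀ (by positivity)]; linarith
  have h1 : zs j = α j * zs a := by rw [hzl j hjA, hbj]; ring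
  have h2 : α j * (e / (2 * S1)) ≤ C * x j :=
    (mul_le_mul_of_nonneg_left h0 (hαβ j hjA).1).trans (h1.symm.le.trans (hzx j hjA))
  have h3 : c1 * e ≤ α j / (2 * S1 * C) * e :=
    mul_le_mul_of_nonneg_right (hlow j hj) hep.le
  have h4 : α j / (2 * S1 * C) * e = α j * (e / (2 * S1)) / C := by field_simp
  rw [h4] at h3
  refine h3.trans ?_
  rw [div_le_iff₀ hC0]; linarith

lemma zero_step {J ι : Type*} [Fintype J] [Fintype ι] [DecidableEq J] (y y' : ι → J → ℕ)
    (V : Submodule ℝ (J → ℝ)) (hWR : WR y y' V) (m M : ℝ) (hm : 0 < m) (hM : m ≤ M)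
    (A : Finset J) (a b : J) (ha : a ∈ A) (hb : b ∈ A) (α β : J → ℝ)
    (hαβ : ∀ j ∈ A, 0 ≤ α j ∧ 0 ≤ β j ∧ 0 < α j + β j) (hαa : α a = 1) (hβa : β a = 0)
    (hαb : α b = 0) (hβb : β b = 1)
    (D : ℕ) (hD : ∀ i i', ∑ j ∈ A, |(y i j : ℤ) - y i' j| ≤ D)
    (J1 : Finset J) (hJ1 : ∀ j, j ∈ J1 ↔ j ∈ A ∧ β j = 0)
    (J2 : Finset J) (hJ2 : ∀ j, j ∈ J2 ↔ j ∈ A ∧ α j = 0) (Jw : Finset J)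
    (C cl Cu : ℝ) (hC : 1 ≤ C) (hcl : 0 < cl) (q : ℕ) (hq : q = (D+1).factorial) :
    ∃ η0 > (0:ℝ), ∃ K ≥ (0:ℝ), ∀ (η : ℝ) (κ : ι → ℝ) (x zt zs : J → ℝ), 0 < η → η ≤ η0 →
      (∀ i, m ≤ κ i ∧ κ i ≤ M) → (∀ j, 0 < x j) → (∀ j ∈ A, x j ≤ zt j) →
      (∀ j ∈ A, zs j ≤ C * x j) → (∀ j ∈ A, 0 < zs j) →
      (∀ j ∈ A, zs j = α j * zs a + β j * zs b) →
      (∀ j, j ∉ A → cl ≤ x j ∧ x j ≤ Cu) →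
      (∑ j ∈ A, zt j ≤ 2 * η ^ (2 * q)) →
      (η ^ (2 * q) / 2 ≤ ∑ j ∈ A, zs j) →
      (-(K * η * η ^ (2 * q + 1)) ≤ ∑ i, κ i * mon x (y i) *
        ∑ j, ((if j ∈ A then (q : ℝ) else 0) + (if j ∈ Jw then ((0 : ℕ) : ℝ) else 0)) *
          ((y' i j : ℝ) - y i j)) ∧
      (η ^ (2 * q + 1) / 2 ≤ ∑ j ∈ J1, zs j → η ^ (2 * q + 1) / 2 ≤ ∑ j ∈ J2, zs j →
        0 ≤ ∑ i, κ i * mon x (y i) *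
        ∑ j, ((if j ∈ A then (q : ℝ) else 0) + (if j ∈ Jw then ((0 : ℕ) : ℝ) else 0)) *
          ((y' i j : ℝ) - y i j)) := by
  have hsub1 : J1 ⊆ A := fun j hj => ((hJ1 j).1 hj).1
  have hsub2 : J2 ⊆ A := fun j hj => ((hJ2 j).1 hj).1
  have hsub : J1 ∪ J2 ⊆ A := Finset.union_subset hsub1 hsub2
  set Sα := ∑ j ∈ A, α j with hSα
  set Sβ := ∑ j ∈ A, β j with hSβ
  have hSαp : 0 < Sα := by
    have := Finset.single_le_sum (f := α) (fun j hj => (hαβ j hj).1) ha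
    linarith
  have hSβp : 0 < Sβ := by
    have := Finset.single_le_sum (f := β) (fun j hj => (hαβ j hj).2.1) hb
    linarith
  have hC0 : 0 < C := by linarith
  obtain ⟨c1, hc1, hlow1⟩ := low_J1 A a b ha α β hαβ hαa hβa J1 hJ1 C hC
  obtain ⟨c3, hc3, hlow3⟩ := low_J1 A b a hb β α (fun j hj => by
    have := hαβ j hj; exact ⟨this.2.1, this.1, by linarith⟩) hβb hαb J2 hJ2 C hC
  obtain ⟨c2, hc2, hc2'⟩ := exists_low (A \ (J1 ∪ J2))
    (fun j => min (α j / Sα) (β j / Sβ) / (2 * C)) (fun j hj => by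
    rw [Finset.mem_sdiff, Finset.mem_union, hJ1, hJ2] at hj
    push Not at hj
    have h := hαβ j hj.1
    have h1 : 0 < β j := lt_of_le_of_ne h.2.1 (fun h' => hj.2.1 hj.1 h'.symm)
    have h2 : 0 < α j := lt_of_le_of_ne h.1 (fun h' => hj.2.2 hj.1 h'.symm)
    positivity)
  set c := min (min (min c1 c3) c2) (min cl 1) with hc
  have hcp : 0 < c := by positivity
  set Cc := max 2 Cu with hCc
  have hCc2 : 2 ≤ Cc := le_max_left _ _
  have hc1c : c ≤ c1 := (min_le_left _ _).trans ((min_le_left _ _).trans (min_le_left _ _))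
  have hc3c : c ≤ c3 := (min_le_left _ _).trans ((min_le_left _ _).trans (min_le_right _ _))
  have hc2c : c ≤ c2 := (min_le_left _ _).trans (min_le_right _ _)
  have hclc : c ≤ cl := (min_le_right _ _).trans (min_le_left _ _)
  have hc1' : c ≤ 1 := (min_le_right _ _).trans (min_le_right _ _)
  obtain ⟨η0, hη0, K, hK, hstep⟩ := step_gen y y' V hWR
    (fun j => (if j ∈ A then (q : ℝ) else 0) + (if j ∈ Jw then ((0 : ℕ) : ℝ) else 0))
    m M hm hM (J1 ∪ J2) (A \ (J1 ∪ J2)) Finset.disjoint_sdiff (2 * q) (2 * q + 1)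
    (2 * q) (by omega) c Cc hcp (by linarith) (by linarith) (by
      intro i i' hV hpos
      rw [lamsum A Jw _ _ (fun j => (y i j : ℝ) - y i' j)] at hpos
      rw [Nat.cast_zero, zero_mul, add_zero] at hpos
      have hqp : 0 < (q : ℝ) := by rw [hq]; exact_mod_cast Nat.factorial_pos _
      have hN : 0 < ∑ j ∈ A, ((y i j : ℝ) - y i' j) := pos_of_mul_pos_right hpos hqp.le
      have hN' : (0 : ℤ) < ∑ j ∈ A, ((y i j : ℤ) - y i' j) := by exact_mod_cast hN
      have hN1 : (1 : ℝ) ≤ ∑ j ∈ A, ((y i j : ℝ) - y i' j) := by exact_mod_cast hN'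
      have hDr : ∑ j ∈ A, |(y i j : ℝ) - y i' j| ≤ D := by exact_mod_cast hD i i'
      have hqD : (D : ℝ) + 1 ≤ q := by
        rw [hq]; exact_mod_cast Nat.self_le_factorial (D + 1)
      have hsplit := Finset.sum_sdiff (f := fun j => (y i j : ℝ) - y i' j) hsub
      have h1 : ∑ j ∈ J1 ∪ J2, ((2 * q) * ((y i j : ℝ) - y i' j) - |(y i j : ℝ) - y i' j|) ≤
        ∑ j ∈ J1 ∪ J2, min (((2 * q : ℕ) : ℝ) * ((y i j : ℝ) - y i' j))
          (((2 * q + 1 : ℕ) : ℝ) * ((y i j : ℝ) - y i' j)) := by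
        refine Finset.sum_le_sum fun j _ => le_min ?_ ?_
        · push_cast
          linarith [abs_nonneg ((y i j : ℝ) - y i' j)]
        · push_cast
          linarith [neg_abs_le ((y i j : ℝ) - y i' j)]
      rw [Finset.sum_sub_distrib, ← Finset.mul_sum] at h1
      have h2 : ∑ j ∈ J1 ∪ J2, |(y i j : ℝ) - y i' j| ≤ D :=
        (Finset.sum_le_sum_of_subset_of_nonneg hsub fun j _ _ => abs_nonneg _).trans hDr
      have h3 := mul_le_mul_of_nonneg_left hN1 hqp.le
      rw [← hsplit] at h3
      push_cast at h1 ⊢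
      have hD0 : (0:ℝ) ≤ D := Nat.cast_nonneg _
      linarith)
  refine ⟨min 1 η0, by positivity, K, hK, ?_⟩
  intro η κ x zt zs hη hη' hκ hx hxz hzx hzs hzl hO hN hNs
  have hη1 : η ≤ 1 := hη'.trans (min_le_left _ _)
  have hη2 : η ≤ η0 := hη'.trans (min_le_right _ _)
  set h := η ^ (2 * q) with hh
  have hhp : 0 < h := by positivity
  have hzt : ∀ j ∈ A, 0 < zt j := fun j hj => (hx j).trans_le (hxz j hj)
  have hup : ∀ j ∈ A, x j ≤ Cc * h := by
    intro j hj
    have h1 := Finset.single_le_sum (f := zt) (fun j hj => (hzt j hj).le) hj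
    have h2 : 2 * h ≤ Cc * h := by gcongr
    linarith [hxz j hj]
  have hsumA : ∑ j ∈ A, zs j = Sα * zs a + Sβ * zs b := by
    rw [hSα, hSβ, Finset.sum_mul, Finset.sum_mul, ← Finset.sum_add_distrib]
    exact Finset.sum_congr rfl hzl
  have hH : ∀ j ∈ A \ (J1 ∪ J2), c * h ≤ x j ∧ x j ≤ Cc * h := by
    intro j hj
    have hjA := (Finset.mem_sdiff.1 hj).1
    refine ⟨?_, hup j hjA⟩
    have h0 := hc2c.trans (hc2' j hj)
    rw [le_div_iff₀ (by positivity)] at h0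
    have hA1 : c * (2 * C) * Sα ≤ α j := by
      rw [← le_div_iff₀ hSαp]; exact h0.trans (min_le_left _ _)
    have hB1 : c * (2 * C) * Sβ ≤ β j := by
      rw [← le_div_iff₀ hSβp]; exact h0.trans (min_le_right _ _)
    have h1 := mul_le_mul_of_nonneg_right hA1 (hzs a ha).le
    have h2 := mul_le_mul_of_nonneg_right hB1 (hzs b hb).le
    have h3 : c * (2 * C) * (h / 2) ≤ c * (2 * C) * (Sα * zs a + Sβ * zs b) := by
      rw [← hsumA]; gcongr
    have h4 := hzx j hjA
    rw [hzl j hjA] at h4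
    have h5 : C * (c * h) ≤ C * x j := by linarith
    exact le_of_mul_le_mul_left h5 hC0
  have hO' : ∀ j, j ∉ J1 ∪ J2 → j ∉ A \ (J1 ∪ J2) → c ≤ x j ∧ x j ≤ Cc := by
    intro j hj1 hj2
    have hjA : j ∉ A := fun h => hj2 (Finset.mem_sdiff.2 ⟨h, hj1⟩)
    exact ⟨hclc.trans (hO j hjA).1, (hO j hjA).2.trans (le_max_right _ _)⟩
  obtain ⟨r1, r2, r3⟩ := hstep η κ x hη hη2 hκ hx (fun j hj => hup j (hsub hj)) hH hO'
  refine ⟨r1, fun hl1 hl2 => r2 ?_⟩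
  have hep : 0 < η ^ (2 * q + 1) := by positivity
  intro j hj
  rcases Finset.mem_union.1 hj with hj | hj
  · exact (mul_le_mul_of_nonneg_right hc1c hep.le).trans
      (hlow1 x zs _ hep hzx hzl hl1 j hj)
  · exact (mul_le_mul_of_nonneg_right hc3c hep.le).trans
      (hlow3 x zs _ hep hzx (fun j hj => by rw [hzl j hj]; ring) hl2 j hj)


lemma unified {J ι : Type*} [Fintype J] [Fintype ι] [DecidableEq J] (y y' : ι → J → ℕ)
    (V : Submodule ℝ (J → ℝ)) (hWR : WR y y' V) (m M : ℝ) (hm : 0 < m) (hM : m ≤ M)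
    (A : Finset J) (a b : J) (ha : a ∈ A) (hb : b ∈ A) (α β : J → ℝ)
    (hαβ : ∀ j ∈ A, 0 ≤ α j ∧ 0 ≤ β j ∧ 0 < α j + β j) (hαa : α a = 1) (hβa : β a = 0)
    (hαb : α b = 0) (hβb : β b = 1)
    (hlin : ∀ Y ∈ V, ∀ j ∈ A, Y j = α j * Y a + β j * Y b)
    (D : ℕ) (hD : ∀ i i', ∑ j ∈ A, |(y i j : ℤ) - y i' j| ≤ D)
    (Jw : Bool → Finset J) (hJ1 : ∀ j, j ∈ Jw true ↔ j ∈ A ∧ β j = 0)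
    (hJ2 : ∀ j, j ∈ Jw false ↔ j ∈ A ∧ α j = 0)
    (C cl Cu : ℝ) (hC : 1 ≤ C) (hcl : 0 < cl) (q : ℕ) (hq : q = (D+1).factorial) (w : Bool) (k : ℕ) :
    ∃ η0 > (0:ℝ), ∃ K ≥ (0:ℝ), ∀ (η : ℝ) (κ : ι → ℝ) (x zt zs : J → ℝ), 0 < η → η ≤ η0 →
      (∀ i, m ≤ κ i ∧ κ i ≤ M) → (∀ j, 0 < x j) → (∀ j ∈ A, x j ≤ zt j) →
      (∀ j ∈ A, zs j ≤ C * x j) → (∀ j ∈ A, 0 < zs j) →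
      (∀ j ∈ A, zs j = α j * zs a + β j * zs b) →
      (∀ j, j ∉ A → cl ≤ x j ∧ x j ≤ Cu) →
      (∑ j ∈ A, zt j ≤ 2 * η ^ (2 * q)) →
      (η ^ (2 * q) / 2 ≤ ∑ j ∈ A, zs j) →
      (∀ k', k = k' + 1 → ∑ j ∈ Jw w, zt j ≤ 2 * η ^ (2 * q + 2 * k' + 1)) →
      (-(K * η * η ^ (2 * q + 2 * k + 1)) ≤ ∑ i, κ i * mon x (y i) *
        ∑ j, ((if j ∈ A then (q : ℝ) else 0) + (if j ∈ Jw w then (k : ℝ) else 0)) *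
          ((y' i j : ℝ) - y i j)) ∧
      ((k < q * (D + 1) → ∀ w', (w' = w ∨ k = 0) →
          η ^ (2 * q + 2 * k + 1) / 2 ≤ ∑ j ∈ Jw w', zs j) → 0 ≤ ∑ i, κ i * mon x (y i) *
        ∑ j, ((if j ∈ A then (q : ℝ) else 0) + (if j ∈ Jw w then (k : ℝ) else 0)) *
          ((y' i j : ℝ) - y i j)) := by
  have hq0 : 0 < q := by rw [hq]; exact Nat.factorial_pos _
  rcases k with _ | k
  · obtain ⟨η0, hη0, K, hK, h⟩ := zero_step y y' V hWR m M hm hM A a b ha hb α β hαβ hαa hβa hαb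
      hβb D hD _ hJ1 _ hJ2 (Jw w) C cl Cu hC hcl q hq
    refine ⟨η0, hη0, K, hK, ?_⟩
    intro η κ x zt zs h1 h2 h3 h4 h5 h6 h7 h8 h9 h10 h11 h12
    obtain ⟨r1, r2⟩ := h η κ x zt zs h1 h2 h3 h4 h5 h6 h7 h8 h9 h10 h11
    refine ⟨r1, fun hp => r2 ?_ ?_⟩
    · exact hp (by positivity) true (Or.inr rfl)
    · exact hp (by positivity) false (Or.inr rfl)
  · cases w with
    | true =>
      obtain ⟨η0, hη0, K, hK, h⟩ := wing y y' V hWR m M hm hM A a b ha hb α β hαβ hαa hβa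
        hβb hlin D hD _ hJ1 k C cl Cu hC hcl q hq
      refine ⟨η0, hη0, K, hK, ?_⟩
      intro η κ x zt zs h1 h2 h3 h4 h5 h6 h7 h8 h9 h10 h11 h12
      obtain ⟨r1, r2, r3⟩ := h η κ x zt zs h1 h2 h3 h4 h5 h6 h7 h8 h9 (h12 k rfl) h10 h11
      refine ⟨r1, fun hp => ?_⟩
      by_cases hk : k + 1 < q * (D + 1)
      · exact r2 (hp hk true (Or.inl rfl))
      · exact r3 (by omega)
    | false =>
      obtain ⟨η0, hη0, K, hK, h⟩ := wing y y' V hWR m M hm hM A b a hb ha β α (fun j hj => by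
        have := hαβ j hj; exact ⟨this.2.1, this.1, by linarith⟩) hβb hαb
        hαa (fun Y hY j hj => by rw [hlin Y hY j hj]; ring) D hD _ hJ2 k C cl Cu hC hcl q hq
      refine ⟨η0, hη0, K, hK, ?_⟩
      intro η κ x zt zs h1 h2 h3 h4 h5 h6 h7 h8 h9 h10 h11 h12
      obtain ⟨r1, r2, r3⟩ := h η κ x zt zs h1 h2 h3 h4 h5 h6 h7
        (fun j hj => by rw [h8 j hj]; ring) h9 (h12 k rfl) h10 h11
      refine ⟨r1, fun hp => ?_⟩
      by_cases hk : k + 1 < q * (D + 1)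
      · exact r2 (hp hk false (Or.inl rfl))
      · exact r3 (by omega)


lemma deriv_lin {J ι : Type*} [Fintype J] [Fintype ι] (y y' : ι → J → ℕ)
    (z X : ℝ → J → ℝ) (κ : ℝ → ι → ℝ) (t : ℝ)
    (hder : ∀ j, HasDerivAt (fun t => z t j)
      (∑ i, κ t i * mon (X t) (y i) * ((y' i j : ℝ) - y i j)) t) (lam : J → ℝ) :
    HasDerivAt (fun t => ∑ j, lam j * z t j)
      (∑ i, κ t i * mon (X t) (y i) * ∑ j, lam j * ((y' i j : ℝ) - y i j)) t := by
  have h := HasDerivAt.fun_sum (u := Finset.univ) (fun j _ => (hder j).const_mul (lam j))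
  refine h.congr_deriv ?_
  simp only [Finset.mul_sum]
  rw [Finset.sum_comm]
  refine Finset.sum_congr rfl fun i _ => Finset.sum_congr rfl fun j _ => ?_
  ring

lemma vertex {J ι : Type*} [Fintype J] [Fintype ι] [DecidableEq J] (y y' : ι → J → ℕ)
    (V : Submodule ℝ (J → ℝ)) (hWR : WR y y' V) (m M : ℝ) (hm : 0 < m) (hM : m ≤ M)
    (A : Finset J) (a b : J) (ha : a ∈ A) (hb : b ∈ A) (α β : J → ℝ)
    (hαβ : ∀ j ∈ A, 0 ≤ α j ∧ 0 ≤ β j ∧ 0 < α j + β j) (hαa : α a = 1) (hβa : β a = 0)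
    (hαb : α b = 0) (hβb : β b = 1)
    (hlin : ∀ Y ∈ V, ∀ j ∈ A, Y j = α j * Y a + β j * Y b)
    (C : ℝ) (hC : 1 ≤ C) (t1 T : ℝ) (hT : 0 < T) (z X : ℝ → J → ℝ) (κ : ℝ → ι → ℝ) (Mz : ℝ)
    (hκ : ∀ t ≥ t1, ∀ i, m ≤ κ t i ∧ κ t i ≤ M)
    (hX : ∀ t ≥ t1, ∀ j, 0 < X t j ∧ X t j ≤ z t j ∧ z t j ≤ Mz)
    (hzX : ∀ t ≥ t1 + T, ∀ j, z (t - T) j ≤ C * X t j)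
    (hder : ∀ t ≥ t1, ∀ j, HasDerivAt (fun t => z t j)
      (∑ i, κ t i * mon (X t) (y i) * ((y' i j : ℝ) - y i j)) t)
    (hzl : ∀ t ≥ t1, ∀ j ∈ A, z t j = α j * z t a + β j * z t b)
    (ε1 : ℝ) (hε1 : 0 < ε1)
    (hO : ∀ t ≥ t1, (∀ j ∈ A, z t j < ε1) → ∀ l, l ∉ A → ε1 ≤ z t l) :
    ∃ δ > (0:ℝ), ∀ t ≥ t1, δ ≤ ∑ j ∈ A, z t j := by
  classical
  obtain ⟨D, hD⟩ : ∃ D : ℕ, ∀ i i', ∑ j ∈ A, |(y i j : ℤ) - y i' j| ≤ D := by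
    refine ⟨(∑ i, ∑ i', ∑ j ∈ A, |(y i j : ℤ) - y i' j|).toNat, fun i i' => ?_⟩
    refine le_trans ?_ (Int.self_le_toNat _)
    refine le_trans ?_ (Finset.single_le_sum (f := fun i => ∑ i', ∑ j ∈ A, |(y i j : ℤ) - y i' j|)
      (fun i _ => by positivity) (Finset.mem_univ i))
    exact (Finset.single_le_sum (f := fun i' => ∑ j ∈ A, |(y i j : ℤ) - y i' j|)
      (fun i _ => by positivity) (Finset.mem_univ i'))
  obtain ⟨q, hq⟩ : ∃ q : ℕ, q = (D + 1).factorial := ⟨_, rfl⟩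
  have hq0 : 0 < q := by rw [hq]; exact Nat.factorial_pos _
  have hq1 : (1:ℝ) ≤ q := by exact_mod_cast hq0
  set Km := q * (D + 1) with hKm
  set Jw : Bool → Finset J := fun w => if w then A.filter (fun j => β j = 0) else
    A.filter (fun j => α j = 0) with hJw
  have hJwA : ∀ w, Jw w ⊆ A := by
    intro w; cases w <;> simp [hJw, Finset.filter_subset]
  have hC0 : 0 < C := by linarith
  have huni := unified y y' V hWR m M hm hM A a b ha hb α β hαβ hαa hβa hαb hβb hlin D hD Jw
    (by simp [hJw]) (by simp [hJw]) C (ε1 / C) Mz hC (by positivity) q hq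
  choose η0 hη0 K hK huni using huni
  -- initial lower bound
  have hNcont : ∀ t ≥ t1, ContinuousAt (fun t => ∑ j ∈ A, z t j) t := by
    intro t ht
    exact tendsto_finsetSum A fun j _ => (hder t ht j).continuousAt
  have hNpos : ∀ t ≥ t1, 0 < ∑ j ∈ A, z t j := fun t ht =>
    Finset.sum_pos (fun j _ => (hX t ht j).1.trans_le (hX t ht j).2.1) ⟨a, ha⟩
  obtain ⟨ν, hν, hνN⟩ : ∃ ν > (0:ℝ), ∀ t ∈ Set.Icc t1 (t1 + T), ν ≤ ∑ j ∈ A, z t j := by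
    obtain ⟨s, hs, hmin⟩ := isCompact_Icc.exists_isMinOn (s := Set.Icc t1 (t1 + T))
      (f := fun t => ∑ j ∈ A, z t j) ⟨t1, le_rfl, by linarith⟩
      (fun t ht => (hNcont t ht.1).continuousWithinAt)
    exact ⟨_, hNpos s hs.1, fun t ht => hmin ht⟩
  obtain ⟨e0, he0, he0'⟩ := exists_low (Finset.univ : Finset (Bool × Fin (Km + 1)))
    (fun p => η0 p.1 p.2) (fun p _ => hη0 _ _)
  set Ks : ℝ := ∑ p : Bool × Fin (Km + 1), K p.1 p.2 with hKs
  have hKs0 : 0 ≤ Ks := Finset.sum_nonneg fun p _ => hK _ _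
  have hKle : ∀ w (k : Fin (Km + 1)), K w k ≤ Ks := fun w k =>
    Finset.single_le_sum (f := fun p : Bool × Fin (Km + 1) => K p.1 p.2) (fun p _ => hK _ _)
      (Finset.mem_univ (w, k))
  obtain ⟨η, hη, h1, h2, h3, h4, h5⟩ : ∃ η > (0:ℝ), η ≤ e0 ∧ η ≤ 1 / (Km + 1) ∧
      η ≤ ε1 / (4 * C) ∧ η ≤ ν / 2 ∧ η ≤ 1 / (4 * T * (Ks + 1)) := by
    refine ⟨min e0 (min (1 / (Km + 1)) (min (ε1 / (4 * C)) (min (ν / 2) (1 / (4 * T * (Ks + 1)))))),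
      by positivity, min_le_left _ _, ?_, ?_, ?_, ?_⟩
    · exact (min_le_right _ _).trans (min_le_left _ _)
    · exact (min_le_right _ _).trans ((min_le_right _ _).trans (min_le_left _ _))
    · exact (min_le_right _ _).trans ((min_le_right _ _).trans ((min_le_right _ _).trans
        (min_le_left _ _)))
    · exact (min_le_right _ _).trans ((min_le_right _ _).trans ((min_le_right _ _).trans
        (min_le_right _ _)))
  have hη1 : η ≤ 1 := h2.trans (by
    rw [div_le_one (by positivity)]; have : (0:ℝ) ≤ Km := Nat.cast_nonneg _; linarith)
  have hηK : (Km : ℝ) * η ≤ 1 := by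
    rw [le_div_iff₀ (by positivity)] at h2; linarith
  have hη3 : 4 * C * η ≤ ε1 := by
    rw [le_div_iff₀ (by positivity)] at h3; linarith
  have hη5 : Ks * η ≤ 1 / (4 * T) := by
    rw [le_div_iff₀ (by positivity)] at h5 ⊢
    nlinarith [mul_pos hη hT]
  set h := η ^ (2 * q) with hh
  have hhp : 0 < h := by positivity
  have hhη : h ≤ η := by
    calc h ≤ η ^ 1 := pow_le_pow_of_le_one hη.le hη1 (by omega)
      _ = η := pow_one _
  set p : ℕ → ℝ := fun i => η ^ (2 * q + 2 * i + 1) with hp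
  have hpp : ∀ i, 0 < p i := fun i => by simp only [hp]; positivity
  have hphη : ∀ i, p i ≤ h * η := by
    intro i
    have : h * η = η ^ (2 * q + 1) := by rw [pow_succ]
    rw [this]
    exact pow_le_pow_of_le_one hη.le hη1 (by omega)
  have hph : ∀ i, p i ≤ h := fun i => (hphη i).trans (by nlinarith)
  have hpanti : ∀ i, p (i + 1) ≤ p i := fun i =>
    pow_le_pow_of_le_one hη.le hη1 (by omega)
  set c : ℕ → ℝ := fun k => q * h + ∑ i ∈ Finset.range k, p i with hc
  have hcle : ∀ k ≤ Km, c k ≤ 2 * q * h := by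
    intro k hk
    have h6 : ∑ i ∈ Finset.range k, p i ≤ k * (h * η) := by
      have := Finset.sum_le_card_nsmul (Finset.range k) p _ (fun i _ => hphη i)
      simpa using this
    have h7 : (k : ℝ) * (h * η) ≤ Km * (h * η) := by gcongr
    have h8 : (Km : ℝ) * (h * η) = h * (Km * η) := by ring
    have h9 : h * (Km * η) ≤ h * 1 := by gcongr
    have h10 : h * 1 ≤ h * q := by gcongr
    simp only [hc]
    linarith
  have hcs : ∀ k, c (k + 1) = c k + p k := by
    intro k; simp only [hc]; rw [Finset.sum_range_succ]; ring
  -- barrier functions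
  set lam : Bool × Fin (Km + 1) → J → ℝ := fun i j =>
    (if j ∈ A then (q : ℝ) else 0) + (if j ∈ Jw i.1 then ((i.2 : ℕ) : ℝ) else 0) with hlam
  set N : ℝ → ℝ := fun t => ∑ j ∈ A, z t j with hN
  set Nw : Bool → ℝ → ℝ := fun w t => ∑ j ∈ Jw w, z t j with hNw
  have hR : ∀ i t, ∑ j, lam i j * z t j = q * N t + ((i.2 : ℕ) : ℝ) * Nw i.1 t := by
    intro i t
    exact lamsum A (Jw i.1) q ((i.2 : ℕ) : ℝ) (z t)
  have hNw0 : ∀ w, ∀ t ≥ t1, 0 ≤ Nw w t := fun w t ht =>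
    Finset.sum_nonneg fun j _ => ((hX t ht j).1.trans_le (hX t ht j).2.1).le
  have hbar := barrier (I := Bool × Fin (Km + 1)) (fun i t => ∑ j, lam i j * z t j)
    (fun i t => ∑ s, κ t s * mon (X t) (y s) * ∑ j, lam i j * ((y' s j : ℝ) - y s j))
    (fun i => c i.2) (fun i => p i.2 / 2) t1 T hT
    (fun i t ht => deriv_lin y y' z X κ t (hder t ht) (lam i)) ?_ (fun i => by
      have := hpp i.2; positivity) ?_
  · refine ⟨h / 2, by positivity, fun t ht => ?_⟩
    have h6 := hbar (true, 0) t ht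
    simp only [hR] at h6
    simp only [Fin.val_zero, Nat.cast_zero, zero_mul, add_zero, hc, Finset.range_zero,
      Finset.sum_empty] at h6
    have h7 := hph 0
    have h8 : (q:ℝ) * (h / 2) ≤ q * N t := by nlinarith
    exact le_of_mul_le_mul_left h8 (by linarith)
  · intro i t ht
    simp only [hR]
    have h6 := hcle i.2 (by omega)
    have h7 := hνN t ht
    have h8 := mul_nonneg (Nat.cast_nonneg (α := ℝ) (i.2 : ℕ)) (hNw0 i.1 t ht.1)
    have h9 : (q:ℝ) * (2 * h) ≤ q * N t := by
      refine mul_le_mul_of_nonneg_left ?_ (by linarith)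
      linarith
    linarith
  · rintro ⟨w, k⟩ t ht hinv hle
    simp only [hR] at hinv hle ⊢
    have hkK : (k : ℕ) ≤ Km := by omega
    have htt : t1 ≤ t := by linarith
    have htT : t1 ≤ t - T := by linarith
    have hinvt : ∀ w (k' : ℕ), k' ≤ Km → c k' - p k' / 2 ≤ q * N t + k' * Nw w t :=
      fun w k' hk' => hinv (w, ⟨k', by omega⟩) t ⟨htt, le_rfl⟩
    have hinvs : ∀ w (k' : ℕ), k' ≤ Km → c k' - p k' / 2 ≤ q * N (t - T) + k' * Nw w (t - T) :=
      fun w k' hk' => hinv (w, ⟨k', by omega⟩) (t - T) ⟨htT, by linarith⟩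
    have hNt : N t ≤ 2 * h := by
      have h6 := hcle k hkK
      have h8 := mul_nonneg (Nat.cast_nonneg (α := ℝ) (k : ℕ)) (hNw0 w t htt)
      have h9 : (q:ℝ) * N t ≤ q * (2 * h) := by linarith
      exact le_of_mul_le_mul_left h9 (by linarith)
    have hNs : h / 2 ≤ N (t - T) := by
      have h6 := hinvs true 0 (by omega)
      simp only [Nat.cast_zero, zero_mul, add_zero, hc, Finset.range_zero, Finset.sum_empty] at h6
      have h7 := hph 0
      have h8 : (q:ℝ) * (h / 2) ≤ q * N (t - T) := by nlinarith
      exact le_of_mul_le_mul_left h8 (by linarith)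
    have hzt : ∀ j ∈ A, z t j ≤ 2 * h := fun j hj =>
      (Finset.single_le_sum (f := fun j => z t j)
        (fun j _ => ((hX t htt j).1.trans_le (hX t htt j).2.1).le) hj).trans hNt
    have hzs : ∀ j ∈ A, z (t - T) j < ε1 := by
      intro j hj
      have h6 := hzX t ht j
      have h7 := (hX t htt j).2.1.trans (hzt j hj)
      have h8 : C * X t j ≤ C * (2 * η) := by gcongr; linarith
      nlinarith [mul_pos hC0 hη]
    have hOt : ∀ j, j ∉ A → ε1 / C ≤ X t j ∧ X t j ≤ Mz := by
      intro j hj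
      refine ⟨?_, (hX t htt j).2.1.trans (hX t htt j).2.2⟩
      rw [div_le_iff₀ hC0]
      have := (hO (t - T) htT hzs j hj).trans (hzX t ht j)
      linarith
    obtain ⟨r1, r2⟩ := huni w k η (κ t) (X t) (z t) (z (t - T)) hη
      (h1.trans (he0' (w, k) (Finset.mem_univ _))) (hκ t htt) (fun j => (hX t htt j).1)
      (fun j _ => (hX t htt j).2.1) (fun j _ => hzX t ht j)
      (fun j _ => (hX _ htT j).1.trans_le (hX _ htT j).2.1) (hzl _ htT) hOt hNt hNs
      (by
        intro k' hk'
        have h6 := hinvt w k' (by omega)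
        change Nw w t ≤ 2 * p k'
        simp only [hk', hcs] at hle
        push_cast at hle
        linarith [hpp k'])
    constructor
    · refine le_trans ?_ r1
      change -(p k / 2 / (2 * T)) ≤ -(K w k * η * p k)
      have h6 : K w k * η ≤ 1 / (4 * T) := (mul_le_mul_of_nonneg_right (hKle w k) hη.le).trans hη5
      have h7 := mul_le_mul_of_nonneg_right h6 (hpp k).le
      have h8 : 1 / (4 * T) * p k = p k / 2 / (2 * T) := by field_simp; ring
      linarith
    · intro hs
      refine r2 ?_
      intro hk w' hw'
      change p k / 2 ≤ Nw w' (t - T)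
      have h6 := hinvs w' (k + 1) (by omega)
      rw [hcs] at h6
      have h7 := hpanti k
      have h8 : (k : ℕ) * Nw w' (t - T) = (k : ℕ) * Nw w (t - T) := by
        rcases hw' with h | h
        · rw [h]
        · rw [h]; simp
      push_cast at h6
      linarith


lemma edge {J ι : Type*} [Fintype J] [Fintype ι] [DecidableEq J] (y y' : ι → J → ℕ)
    (V : Submodule ℝ (J → ℝ)) (hWR : WR y y' V) (m M : ℝ) (hm : 0 < m) (hM : m ≤ M)
    (A : Finset J) (a : J) (ha : a ∈ A) (cf : J → ℝ) (hcf : ∀ j ∈ A, 0 < cf j)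
    (hlin : ∀ Y ∈ V, ∀ j ∈ A, Y j = cf j * Y a)
    (C : ℝ) (hC : 1 ≤ C) (t1 T : ℝ) (hT : 0 < T) (z X : ℝ → J → ℝ) (κ : ℝ → ι → ℝ) (Mz : ℝ)
    (hκ : ∀ t ≥ t1, ∀ i, m ≤ κ t i ∧ κ t i ≤ M)
    (hX : ∀ t ≥ t1, ∀ j, 0 < X t j ∧ X t j ≤ z t j ∧ z t j ≤ Mz)
    (hzX : ∀ t ≥ t1 + T, ∀ j, z (t - T) j ≤ C * X t j)
    (hder : ∀ t ≥ t1, ∀ j, HasDerivAt (fun t => z t j)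
      (∑ i, κ t i * mon (X t) (y i) * ((y' i j : ℝ) - y i j)) t)
    (hzl : ∀ t ≥ t1, ∀ j ∈ A, z t j = cf j * z t a)
    (ε1 : ℝ) (hε1 : 0 < ε1)
    (hO : ∀ t ≥ t1, (∀ j ∈ A, z t j < ε1) → ∀ l, l ∉ A → ε1 ≤ z t l) :
    ∃ δ > (0:ℝ), ∀ t ≥ t1, δ ≤ z t a := by
  have hC0 : 0 < C := by linarith
  set Sc := ∑ j ∈ A, cf j with hSc
  have hScj : ∀ j ∈ A, cf j ≤ Sc := fun j hj =>
    Finset.single_le_sum (f := cf) (fun j hj => (hcf j hj).le) hj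
  set lam : J → ℝ := fun j => if j = a then 1 else 0 with hlam
  have hls : ∀ g : J → ℝ, ∑ j, lam j * g j = g a := by
    intro g; simp [hlam]
  have hSc0 : 0 < Sc := (hcf a ha).trans_le (hScj a ha)
  set Cc := max (max 1 Sc) Mz with hCc
  have hCc1 : 1 ≤ Cc := (le_max_left _ _).trans (le_max_left _ _)
  have hCcS : Sc ≤ Cc := (le_max_right _ _).trans (le_max_left _ _)
  obtain ⟨η0, hη0, K, hK, hstep⟩ := step_gen y y' V hWR lam m M hm hM A ∅ (by simp) 1 1 0 le_rfl
    (min 1 (ε1 / C)) Cc (by positivity) ((min_le_left _ _).trans hCc1) hCc1 (by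
      intro i i' hV hpos
      rw [hls (fun j => (y i j : ℝ) - y i' j)] at hpos
      have h1 : (1:ℝ) ≤ (y i a : ℝ) - y i' a := by
        have : (0:ℤ) < (y i a : ℤ) - y i' a := by exact_mod_cast hpos
        exact_mod_cast this
      have h2 : ∀ j ∈ A, 0 ≤ (y i j : ℝ) - y i' j := by
        intro j hj
        have := hlin _ hV j hj
        rw [this]; exact mul_nonneg (hcf j hj).le hpos.le
      simp only [min_self, Nat.cast_one, one_mul, Finset.sum_empty, mul_zero, add_zero]
      exact h1.trans (Finset.single_le_sum (f := fun j => (y i j : ℝ) - y i' j) h2 ha))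
  obtain ⟨η, hη, h1, h2⟩ : ∃ η > (0:ℝ), η ≤ η0 ∧ η ≤ ε1 / (2 * C * Cc) :=
    ⟨min η0 (ε1 / (2 * C * Cc)), by positivity, min_le_left _ _, min_le_right _ _⟩
  have hη2 : 2 * C * Cc * η ≤ ε1 := by
    rw [le_div_iff₀ (by positivity)] at h2; linarith
  have hzp : ∀ t ≥ t1, ∀ j, 0 < z t j := fun t ht j => (hX t ht j).1.trans_le (hX t ht j).2.1
  have hnn : ∀ t ≥ t1 + T, z t a ≤ η →
      0 ≤ ∑ s, κ t s * mon (X t) (y s) * ∑ j, lam j * ((y' s j : ℝ) - y s j) := by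
    intro t ht hle
    have htt : t1 ≤ t := by linarith
    have htT : t1 ≤ t - T := by linarith
    have hu : ∀ j ∈ A, X t j ≤ Cc * η := by
      intro j hj
      refine (hX t htt j).2.1.trans ?_
      rw [hzl t htt j hj]
      exact mul_le_mul ((hScj j hj).trans hCcS) hle (hzp t htt a).le (by linarith)
    have hzs : ∀ j ∈ A, z (t - T) j < ε1 := by
      intro j hj
      have h6 := hzX t ht j
      have h8 : C * X t j ≤ C * (Cc * η) := by gcongr; exact hu j hj
      have : 0 < C * Cc * η := by positivity
      linarith
    obtain ⟨r1, r2, r3⟩ := hstep η (κ t) (X t) hη h1 (hκ t htt) (fun j => (hX t htt j).1)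
      (by simpa using hu) (by simp) (by
        intro j hj _
        refine ⟨(min_le_right _ _).trans ?_, (hX t htt j).2.1.trans ((hX t htt j).2.2.trans
          (le_max_right _ _))⟩
        rw [div_le_iff₀ hC0]
        have := (hO (t - T) htT hzs j hj).trans (hzX t ht j)
        linarith)
    refine r3 ?_
    intro i i' hV hpos j hj
    rw [hls (fun j => (y i j : ℝ) - y i' j)] at hpos
    have := hlin _ hV j hj
    rw [this]; exact mul_nonneg (hcf j hj).le hpos.le
  obtain ⟨ν, hν, hνN⟩ : ∃ ν > (0:ℝ), ∀ t ∈ Set.Icc t1 (t1 + T), ν ≤ z t a := by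
    obtain ⟨s, hs, hmin⟩ := isCompact_Icc.exists_isMinOn (s := Set.Icc t1 (t1 + T))
      (f := fun t => z t a) ⟨t1, le_rfl, by linarith⟩
      (fun t ht => (hder t ht.1 a).continuousAt.continuousWithinAt)
    exact ⟨_, hzp s hs.1 a, fun t ht => hmin ht⟩
  have hbar := barrier (I := Unit) (fun _ t => z t a)
    (fun _ t => ∑ s, κ t s * mon (X t) (y s) * ∑ j, lam j * ((y' s j : ℝ) - y s j))
    (fun _ => min ν η) (fun _ => min ν η / 2) t1 T hT
    (fun i t ht => by
      have := deriv_lin y y' z X κ t (hder t ht) lam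
      simp only [hls (fun j => z _ j)] at this
      exact this)
    (fun _ t ht => (min_le_left _ _).trans (hνN t ht)) (fun _ => by positivity)
    (fun _ t ht _ hle => by
      have h0 := hnn t ht (hle.trans (min_le_right _ _))
      refine ⟨le_trans ?_ h0, fun _ => h0⟩
      have : 0 ≤ min ν η / 2 / (2 * T) := by positivity
      linarith)
  refine ⟨min ν η / 2, by positivity, fun t ht => ?_⟩
  have := hbar () t ht
  linarith

lemma z_diff {J ι : Type*} [Fintype J] [Fintype ι] [DecidableEq J] (y y' : ι → J → ℕ)
    (V : Submodule ℝ (J → ℝ)) (hst : ∀ i, (fun j => (y' i j : ℝ) - y i j) ∈ V)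
    (t1 : ℝ) (z X : ℝ → J → ℝ) (κ : ℝ → ι → ℝ)
    (hder : ∀ t ≥ t1, ∀ j, HasDerivAt (fun t => z t j)
      (∑ i, κ t i * mon (X t) (y i) * ((y' i j : ℝ) - y i j)) t)
    (s t : ℝ) (hs : t1 ≤ s) (hst' : s ≤ t) : z t - z s ∈ V := by
  by_contra hcon
  obtain ⟨φ, hφ, hφV⟩ := Submodule.exists_le_ker_of_notMem hcon
  set lam : J → ℝ := fun j => φ (Pi.single j 1) with hlam
  have hφl : ∀ v, φ v = ∑ j, lam j * v j := by
    intro v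
    conv_lhs => rw [pi_eq_sum_univ' v]
    rw [map_sum]
    refine Finset.sum_congr rfl fun j _ => ?_
    rw [map_smul, smul_eq_mul, mul_comm]
  have hd : ∀ u ≥ t1, HasDerivAt (fun t => ∑ j, lam j * z t j) 0 u := by
    intro u hu
    refine (deriv_lin y y' z X κ u (hder u hu) lam).congr_deriv ?_
    refine Finset.sum_eq_zero fun i _ => ?_
    have : φ (fun j => (y' i j : ℝ) - y i j) = 0 := hφV (hst i)
    rw [hφl] at this
    rw [this, mul_zero]
  have h1 := mvt_lower (f := fun t => ∑ j, lam j * z t j) (f' := fun _ => 0) (m := 0) hst'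
    (fun u hu => hd u (hs.trans hu.1)) (fun _ _ => le_rfl)
  have h2 := mvt_lower (f := fun t => -∑ j, lam j * z t j) (f' := fun _ => -0) (m := 0) hst'
    (fun u hu => (hd u (hs.trans hu.1)).neg) (fun _ _ => by simp)
  apply hφ
  rw [map_sub, hφl, hφl]
  simp only [zero_mul, add_zero] at h1 h2
  linarith


lemma core {J ι : Type*} [Fintype J] [Fintype ι] [DecidableEq J] (y y' : ι → J → ℕ)
    (V : Submodule ℝ (J → ℝ)) (hWR : WR y y' V) (hV2 : Module.finrank ℝ V ≤ 2)
    (hst : ∀ i, (fun j => (y' i j : ℝ) - y i j) ∈ V)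
    (m M : ℝ) (hm : 0 < m) (hM : m ≤ M)
    (C : ℝ) (hC : 1 ≤ C) (t1 T : ℝ) (hT : 0 < T) (z X : ℝ → J → ℝ) (κ : ℝ → ι → ℝ) (Mz : ℝ)
    (hκ : ∀ t ≥ t1, ∀ i, m ≤ κ t i ∧ κ t i ≤ M)
    (hX : ∀ t ≥ t1, ∀ j, 0 < X t j ∧ X t j ≤ z t j ∧ z t j ≤ Mz)
    (hzX : ∀ t ≥ t1 + T, ∀ j, z (t - T) j ≤ C * X t j)
    (hder : ∀ t ≥ t1, ∀ j, HasDerivAt (fun t => z t j)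
      (∑ i, κ t i * mon (X t) (y i) * ((y' i j : ℝ) - y i j)) t) (j : J) :
    ∃ δ > (0:ℝ), ∃ t0, ∀ t ≥ t0, δ ≤ z t j := by
  classical
  by_contra hcon
  push Not at hcon
  let Sm : Finset J → Prop := fun A => ∀ ε > (0:ℝ), ∀ t0, ∃ t ≥ t0, ∀ j ∈ A, z t j < ε
  have hSj : Sm {j} := by
    intro ε hε t0
    obtain ⟨t, ht, h⟩ := hcon ε hε t0
    exact ⟨t, ht, by simpa using h⟩
  obtain ⟨A, hAm, hAmax⟩ := (Finset.univ.filter Sm).exists_max_image Finset.card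
    ⟨{j}, by simpa using hSj⟩
  have hSA : Sm A := by simpa using hAm
  have hAne : A.Nonempty := by
    have := hAmax {j} (by simpa using hSj)
    rw [Finset.card_singleton] at this
    exact Finset.card_pos.1 (by omega)
  have hl : ∀ l, ∃ ε > (0:ℝ), ∃ t0, l ∉ A → ∀ t ≥ t0, (∀ j ∈ A, z t j < ε) → ε ≤ z t l := by
    intro l
    by_cases hlA : l ∈ A
    · exact ⟨1, one_pos, 0, fun h => absurd hlA h⟩
    · have : ¬ Sm (insert l A) := by
        intro h
        have h1 := hAmax (insert l A) (by simpa using h)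
        rw [Finset.card_insert_of_notMem hlA] at h1
        omega
      simp only [Sm] at this
      push Not at this
      obtain ⟨ε, hε, t0, h⟩ := this
      refine ⟨ε, hε, t0, fun _ t ht hsm => ?_⟩
      obtain ⟨i, hi, hiz⟩ := h t ht
      rcases Finset.mem_insert.1 hi with rfl | hi
      · exact hiz
      · exact absurd (hsm i hi) (not_lt.2 hiz)
  choose εl hεl tl hl using hl
  obtain ⟨ε1, hε1, hε1'⟩ := exists_low Finset.univ εl (fun l _ => hεl l)
  obtain ⟨t2, ht2, ht2'⟩ : ∃ t2 ≥ t1, ∀ l, tl l ≤ t2 := by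
    refine ⟨t1 + ∑ l, |tl l - t1|, ?_, fun l => ?_⟩
    · have : 0 ≤ ∑ l, |tl l - t1| := by positivity
      linarith
    · have := Finset.single_le_sum (f := fun l => |tl l - t1|) (fun l _ => abs_nonneg _)
        (Finset.mem_univ l)
      linarith [le_abs_self (tl l - t1)]
  have hO : ∀ t ≥ t2, (∀ j ∈ A, z t j < ε1) → ∀ l, l ∉ A → ε1 ≤ z t l := by
    intro t ht h l hlA
    exact (hε1' l (Finset.mem_univ _)).trans (hl l hlA t ((ht2' l).trans ht)
      fun j hj => (h j hj).trans_le (hε1' l (Finset.mem_univ _)))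
  -- indicator
  let ind : (J → ℝ) →ₗ[ℝ] (J → ℝ) :=
    { toFun := fun v j => if j ∈ A then v j else 0
      map_add' := by intro u v; ext j; simp only [Pi.add_apply]; split_ifs <;> simp
      map_smul' := by intro c v; ext j; simp only [Pi.smul_apply]; split_ifs <;> simp }
  have hind : ∀ v, ∀ j ∈ A, ind v j = v j := fun v j hj => by simp [ind, hj]
  have hindn : ∀ v j, j ∉ A → ind v j = 0 := fun v j hj => by simp [ind, hj]
  set V' := V.map ind with hV'
  have hV'2 : Module.finrank ℝ V' ≤ 2 := (Submodule.finrank_map_le ind V).trans hV2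
  have hzp : ∀ t ≥ t1, ∀ j, 0 < z t j := fun t ht j => (hX t ht j).1.trans_le (hX t ht j).2.1
  have hzV : ∀ t ≥ t1, ind (z t) ∈ V' := by
    intro t ht
    have hcl : IsClosed (V' : Set (J → ℝ)) := Submodule.closed_of_finiteDimensional V'
    have : ind (z t) ∈ closure (V' : Set (J → ℝ)) := by
      rw [Metric.mem_closure_iff]
      intro ε hε
      obtain ⟨u, hu, huA⟩ := hSA ε hε t
      refine ⟨ind (z t - z u), ?_, ?_⟩
      · have := z_diff y y' V hst t1 z X κ hder t u ht hu
        have h2 : z t - z u ∈ V := by rw [← neg_sub]; exact V.neg_mem this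
        exact Submodule.mem_map_of_mem h2
      · rw [dist_eq_norm, map_sub, sub_sub_cancel, pi_norm_lt_iff hε]
        intro j
        by_cases hj : j ∈ A
        · rw [hind _ _ hj, Real.norm_eq_abs, abs_of_pos (hzp u (ht.le.trans hu) j)]
          exact huA j hj
        · rw [hindn _ _ hj]; simpa using hε
    rwa [hcl.closure_eq] at this
  have hκ2 : ∀ t ≥ t2, ∀ i, m ≤ κ t i ∧ κ t i ≤ M := fun t ht => hκ t (ht2.le.trans ht)
  have hX2 : ∀ t ≥ t2, ∀ j, 0 < X t j ∧ X t j ≤ z t j ∧ z t j ≤ Mz :=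
    fun t ht => hX t (ht2.le.trans ht)
  have hzX2 : ∀ t ≥ t2 + T, ∀ j, z (t - T) j ≤ C * X t j :=
    fun t ht => hzX t (by linarith)
  have hder2 : ∀ t ≥ t2, ∀ j, HasDerivAt (fun t => z t j)
      (∑ i, κ t i * mon (X t) (y i) * ((y' i j : ℝ) - y i j)) t :=
    fun t ht => hder t (ht2.le.trans ht)
  rcases linalg V' hV'2 A hAne (ind (z t2)) (hzV t2 ht2) (fun j hj => by
    rw [hind _ _ hj]; exact hzp t2 ht2 j) with ⟨a, ha, cf, hcf, hrel⟩ |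
      ⟨a, ha, b, hb, α, β, hαβ, hαa, hβa, hαb, hβb, hrel⟩
  · have hlin : ∀ Y ∈ V, ∀ j ∈ A, Y j = cf j * Y a := by
      intro Y hY j hj
      have := hrel (ind Y) (Submodule.mem_map_of_mem hY) j hj
      rwa [hind _ _ hj, hind _ _ ha] at this
    have hzl : ∀ t ≥ t2, ∀ j ∈ A, z t j = cf j * z t a := by
      intro t ht j hj
      have := hrel (ind (z t)) (hzV t (ht2.le.trans ht)) j hj
      rwa [hind _ _ hj, hind _ _ ha] at this
    obtain ⟨δ, hδ, h⟩ := edge y y' V hWR m M hm hM A a ha cf hcf hlin C hC t2 T hT z X κ Mz hκ2 hX2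
      hzX2 hder2 hzl ε1 hε1 hO
    obtain ⟨t, ht, hA⟩ := hSA δ hδ t2
    exact absurd (hA a ha) (not_lt.2 (h t ht))
  · have hlin : ∀ Y ∈ V, ∀ j ∈ A, Y j = α j * Y a + β j * Y b := by
      intro Y hY j hj
      have := hrel (ind Y) (Submodule.mem_map_of_mem hY) j hj
      rwa [hind _ _ hj, hind _ _ ha, hind _ _ hb] at this
    have hzl : ∀ t ≥ t2, ∀ j ∈ A, z t j = α j * z t a + β j * z t b := by
      intro t ht j hj
      have := hrel (ind (z t)) (hzV t (ht2.le.trans ht)) j hj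
      rwa [hind _ _ hj, hind _ _ ha, hind _ _ hb] at this
    obtain ⟨δ, hδ, h⟩ := vertex y y' V hWR m M hm hM A a b ha hb α β hαβ hαa hβa hαb hβb hlin
      C hC t2 T hT z X κ Mz hκ2 hX2 hzX2 hder2 hzl ε1 hε1 hO
    have hcard : 0 < (A.card : ℝ) := by exact_mod_cast Finset.card_pos.2 hAne
    obtain ⟨t, ht, hA⟩ := hSA (δ / A.card) (by positivity) t2
    have h1 : ∑ j ∈ A, z t j < ∑ j ∈ A, δ / A.card := Finset.sum_lt_sum_of_nonempty hAne hA
    rw [Finset.sum_const, nsmul_eq_mul, mul_div_cancel₀ _ hcard.ne'] at h1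
    linarith [h t ht]


lemma cb_reach (y y' : Fin r → Fin n → ℕ) (k : Fin r → ℝ) (hk : ∀ i, 0 < k i)
    (R : Finset (Fin r)) (hCB : ComplexBalancedOn y y' k R) (i : Fin r) (hi : i ∈ R) :
    Relation.ReflTransGen (fun a b => ∃ i ∈ R, y i = a ∧ y' i = b) (y' i) (y i) := by
  classical
  obtain ⟨xb, hxb, hbal⟩ := hCB
  set rel : (Fin n → ℕ) → (Fin n → ℕ) → Prop := fun a b => ∃ i ∈ R, y i = a ∧ y' i = b with hrel
  set A : (Fin n → ℕ) → Prop := fun η => Relation.ReflTransGen rel (y' i) η with hA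
  have hf : ∀ i, 0 < k i * mono xb (y i) := fun i =>
    mul_pos (hk i) (Finset.prod_pos fun j _ => pow_pos (hxb j) _)
  set E := (R.image y ∪ R.image y').filter A with hE
  have h1 : ∑ η ∈ E, ∑ i ∈ R.filter (fun i => y i = η), k i * mono xb (y i)
      = ∑ i ∈ R.filter (fun i => A (y i)), k i * mono xb (y i) := by
    rw [← Finset.sum_fiberwise_of_maps_to (s := R.filter (fun i => A (y i))) (t := E) (g := y)]
    · refine Finset.sum_congr rfl fun η hη => ?_
      refine Finset.sum_congr ?_ fun _ _ => rfl
      ext i'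
      simp only [Finset.mem_filter]
      have : A η := (Finset.mem_filter.1 hη).2
      constructor
      · rintro ⟨h, rfl⟩; exact ⟨⟨h, this⟩, rfl⟩
      · rintro ⟨⟨h, _⟩, h2⟩; exact ⟨h, h2⟩
    · intro i' hi'
      rw [Finset.mem_filter] at hi'
      exact Finset.mem_filter.2 ⟨Finset.mem_union_left _ (Finset.mem_image_of_mem _ hi'.1), hi'.2⟩
  have h2 : ∑ η ∈ E, ∑ i ∈ R.filter (fun i => y' i = η), k i * mono xb (y i)
      = ∑ i ∈ R.filter (fun i => A (y' i)), k i * mono xb (y i) := by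
    rw [← Finset.sum_fiberwise_of_maps_to (s := R.filter (fun i => A (y' i))) (t := E) (g := y')]
    · refine Finset.sum_congr rfl fun η hη => ?_
      refine Finset.sum_congr ?_ fun _ _ => rfl
      ext i'
      simp only [Finset.mem_filter]
      have : A η := (Finset.mem_filter.1 hη).2
      constructor
      · rintro ⟨h, rfl⟩; exact ⟨⟨h, this⟩, rfl⟩
      · rintro ⟨⟨h, _⟩, h2⟩; exact ⟨h, h2⟩
    · intro i' hi'
      rw [Finset.mem_filter] at hi'
      exact Finset.mem_filter.2 ⟨Finset.mem_union_right _ (Finset.mem_image_of_mem _ hi'.1), hi'.2⟩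
  have h3 : ∑ i ∈ R.filter (fun i => A (y i)), k i * mono xb (y i)
      = ∑ i ∈ R.filter (fun i => A (y' i)), k i * mono xb (y i) := by
    rw [← h1, ← h2]; exact Finset.sum_congr rfl fun η _ => hbal η
  have hsub : R.filter (fun i => A (y i)) ⊆ R.filter (fun i => A (y' i)) := by
    intro i' hi'
    rw [Finset.mem_filter] at hi' ⊢
    exact ⟨hi'.1, hi'.2.tail ⟨i', hi'.1, rfl, rfl⟩⟩
  by_contra hcon
  have hlt : ∑ i ∈ R.filter (fun i => A (y i)), k i * mono xb (y i)
      < ∑ i ∈ R.filter (fun i => A (y' i)), k i * mono xb (y i) := by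
    refine Finset.sum_lt_sum_of_subset hsub (i := i) ?_ ?_ (hf i) (fun j _ _ => (hf j).le)
    · exact Finset.mem_filter.2 ⟨hi, Relation.ReflTransGen.refl⟩
    · intro h; exact hcon (Finset.mem_filter.1 h).2
  exact absurd h3 hlt.ne

lemma wr_of_cb (y y' : Fin r → Fin n → ℕ) (k : Fin r → ℝ) (hk : ∀ i, 0 < k i)
    (R : Finset (Fin r)) (hCB : ComplexBalancedOn y y' k R) (W : Finset (Fin n)) :
    WR (J := {j // j ∈ W}) (ι := {i // i ∈ R}) (fun i j => y i j) (fun i j => y' i j)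
      ((stoichOn y y' R).map (LinearMap.funLeft ℝ ℝ (Subtype.val : {j // j ∈ W} → Fin n))) := by
  intro lam i hlt
  have hreach := cb_reach y y' k hk R hCB i i.2
  set L : (Fin n → ℕ) → ℝ := fun η => ∑ j : {j // j ∈ W}, lam j * (η j : ℝ) with hL
  have hstep : ∀ i ∈ R, (fun j => (y' i j : ℝ) - y i j) ∈ stoichOn y y' R := fun i hi =>
    Submodule.subset_span ⟨i, hi, rfl⟩
  have hdiff : ∀ b, Relation.ReflTransGen (fun a b => ∃ i ∈ R, y i = a ∧ y' i = b) (y' i) b →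
      (fun j => (y i j : ℝ) - b j) ∈ stoichOn y y' R := by
    intro b hb
    induction hb with
    | refl =>
      convert (stoichOn y y' R).neg_mem (hstep i i.2) using 1
      ext j; simp
    | tail _ h ih =>
      obtain ⟨i', hi', rfl, rfl⟩ := h
      convert (stoichOn y y' R).sub_mem ih (hstep i' hi') using 1
      ext j; simp
  by_contra hcon
  push Not at hcon
  have hall : ∀ b, Relation.ReflTransGen (fun a b => ∃ i ∈ R, y i = a ∧ y' i = b) (y' i) b →
      L b < L (y i) := by
    intro b hb
    induction hb with
    | refl => exact hlt
    | tail hb h ih =>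
      obtain ⟨i', hi', rfl, rfl⟩ := h
      by_contra hge
      exact hcon ⟨i', hi'⟩ ih (not_lt.1 hge) (Submodule.mem_map.2 ⟨_, hdiff _ hb, by
        ext j; simp [LinearMap.funLeft_apply]⟩)
  exact lt_irrefl _ (hall _ hreach)


lemma mono_cont {X : ℝ → Fin n → ℝ} (hX : Continuous X) (y : Fin n → ℕ) :
    Continuous fun t => mono (X t) y := by
  unfold mono
  exact continuous_finsetProd _ fun j _ => ((continuous_apply j).comp hX).pow _

lemma mono_nn {x : Fin n → ℝ} (hx : ∀ j, 0 ≤ x j) (y : Fin n → ℕ) : 0 ≤ mono x y :=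
  Finset.prod_nonneg fun j _ => pow_nonneg (hx j) _

lemma mono_le {x : Fin n → ℝ} {M : ℝ} (hx : ∀ j, 0 ≤ x j) (hM : ∀ j, x j ≤ M) (y : Fin n → ℕ) :
    mono x y ≤ ∏ j, M ^ y j :=
  Finset.prod_le_prod (fun j _ => pow_nonneg (hx j) _)
    (fun j _ => pow_le_pow_left₀ (hx j) (hM j) _)

lemma mono_le_mul {x : Fin n → ℝ} {M : ℝ} (hx : ∀ j, 0 ≤ x j) (hM : ∀ j, x j ≤ M) (hM1 : 1 ≤ M)
    (y : Fin n → ℕ) (j : Fin n) (hj : y j ≠ 0) :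
    mono x y ≤ x j * ∏ j, M ^ y j := by
  unfold mono
  rw [← Finset.mul_prod_erase univ _ (Finset.mem_univ j),
    ← Finset.mul_prod_erase univ (fun j => M ^ y j) (Finset.mem_univ j), ← mul_assoc]
  refine mul_le_mul ?_ ?_ ?_ ?_
  · obtain ⟨a, ha⟩ := Nat.exists_eq_succ_of_ne_zero hj
    rw [ha, pow_succ, mul_comm]
    refine mul_le_mul_of_nonneg_left ?_ (hx j)
    exact (pow_le_pow_left₀ (hx j) (hM j) _).trans (pow_le_pow_right₀ hM1 (Nat.le_succ a))
  · exact Finset.prod_le_prod (fun j _ => pow_nonneg (hx j) _)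
      (fun j _ => pow_le_pow_left₀ (hx j) (hM j) _)
  · exact Finset.prod_nonneg fun j _ => pow_nonneg (hx j) _
  · exact mul_nonneg (hx j) (pow_nonneg (by linarith) _)

/-- the outflow rate constant -/
noncomputable def outC (y : Fin r → Fin n → ℕ) (k : Fin r → ℝ) (M : ℝ) : ℝ :=
  1 + ∑ i, ∑ j, k i * (∏ j, M ^ y i j) * (y i j : ℝ)

lemma outC_ge (y : Fin r → Fin n → ℕ) (k : Fin r → ℝ) (hk : ∀ i, 0 < k i) {M : ℝ} (hM : 1 ≤ M) :
    1 ≤ outC y k M := by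
  unfold outC
  have : 0 ≤ ∑ i, ∑ j, k i * (∏ j, M ^ y i j) * (y i j : ℝ) :=
    Finset.sum_nonneg fun i _ => Finset.sum_nonneg fun j _ => mul_nonneg (mul_nonneg (hk i).le
      (Finset.prod_nonneg fun j _ => pow_nonneg (by linarith) _)) (Nat.cast_nonneg _)
  linarith

lemma outflow (y : Fin r → Fin n → ℕ) (k : Fin r → ℝ) (hk : ∀ i, 0 < k i) {M : ℝ} (hM1 : 1 ≤ M)
    {x : Fin n → ℝ} (hx : ∀ j, 0 ≤ x j) (hM : ∀ j, x j ≤ M) (j : Fin n) :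
    ∑ i, k i * (mono x (y i) * (y i j : ℝ)) ≤ outC y k M * x j := by
  have hp : ∀ i, 0 ≤ ∏ j, M ^ y i j := fun i =>
    Finset.prod_nonneg fun j _ => pow_nonneg (by linarith) _
  have h1 : ∑ i, k i * (mono x (y i) * (y i j : ℝ)) ≤
      (∑ i, ∑ j, k i * (∏ j, M ^ y i j) * (y i j : ℝ)) * x j := by
    rw [Finset.sum_mul]
    refine Finset.sum_le_sum fun i _ => ?_
    have h2 : k i * (∏ j, M ^ y i j) * (y i j : ℝ) ≤ ∑ j, k i * (∏ j, M ^ y i j) * (y i j : ℝ) :=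
      Finset.single_le_sum (f := fun j => k i * (∏ j, M ^ y i j) * (y i j : ℝ))
        (fun j _ => mul_nonneg (mul_nonneg (hk i).le (hp i)) (Nat.cast_nonneg _))
        (Finset.mem_univ j)
    refine le_trans ?_ (mul_le_mul_of_nonneg_right h2 (hx j))
    by_cases hj : y i j = 0
    · simp [hj]
    · have h3 := mono_le_mul hx hM hM1 (y i) j hj
      have h4 : 0 ≤ k i * (y i j : ℝ) := mul_nonneg (hk i).le (Nat.cast_nonneg _)
      nlinarith [mul_le_mul_of_nonneg_left h3 h4]
  unfold outC
  have := hx j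
  nlinarith

/-- A globally defined positive bounded solution after time `τm`. -/
structure Good (y y' : Fin r → Fin n → ℕ) (k τ : Fin r → ℝ) (τm M : ℝ)
    (X : ℝ → Fin n → ℝ) : Prop where
  cont : Continuous X
  pos : ∀ t j, 0 < X t j
  bd : ∀ t j, X t j ≤ M
  M1 : 1 ≤ M
  kpos : ∀ i, 0 < k i
  t0 : ∀ i, 0 ≤ τ i
  tm : ∀ i, τ i ≤ τm
  tm0 : 0 ≤ τm
  der : ∀ t > τm, ∀ j, HasDerivAt (fun t => X t j)
    (∑ i, k i * (mono (X (t - τ i)) (y i) * (y' i j : ℝ) - mono (X t) (y i) * (y i j : ℝ))) t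

noncomputable def xi (y : Fin r → Fin n → ℕ) (X : ℝ → Fin n → ℝ) (i : Fin r) (t : ℝ) : ℝ :=
  ∫ s in (0:ℝ)..t, mono (X s) (y i)

noncomputable def zz (y y' : Fin r → Fin n → ℕ) (k τ : Fin r → ℝ) (X : ℝ → Fin n → ℝ) (t : ℝ)
    (j : Fin n) : ℝ :=
  X t j + ∑ i, k i * (y' i j : ℝ) * (xi y X i t - xi y X i (t - τ i))

namespace Good
variable {y y' : Fin r → Fin n → ℕ} {k τ : Fin r → ℝ} {τm M : ℝ} {X : ℝ → Fin n → ℝ}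

lemma xi_der (h : Good y y' k τ τm M X) (i : Fin r) (t : ℝ) :
    HasDerivAt (xi y X i) (mono (X t) (y i)) t := by
  have hc := mono_cont h.cont (y i)
  exact intervalIntegral.integral_hasDerivAt_right (hc.intervalIntegrable _ _)
    (hc.stronglyMeasurableAtFilter _ _) hc.continuousAt

lemma xi_mono (h : Good y y' k τ τm M X) (i : Fin r) : Monotone (xi y X i) := by
  refine monotone_of_deriv_nonneg (fun t => (h.xi_der i t).differentiableAt) fun t => ?_
  rw [(h.xi_der i t).deriv]
  exact mono_nn (fun j => (h.pos t j).le) _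

lemma xi_diff (h : Good y y' k τ τm M X) (i : Fin r) {s t : ℝ} (hst : s ≤ t) :
    xi y X i t - xi y X i s ≤ (∏ j, M ^ y i j) * (t - s) := by
  have := mvt_lower (f := fun t => - xi y X i t) (f' := fun t => - mono (X t) (y i))
    (m := -(∏ j, M ^ y i j)) hst (fun u _ => (h.xi_der i u).neg)
    (fun u _ => neg_le_neg (mono_le (fun j => (h.pos u j).le) (h.bd u) _))
  linarith

lemma x_le_z (h : Good y y' k τ τm M X) (t : ℝ) (j : Fin n) : X t j ≤ zz y y' k τ X t j := by
  unfold zz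
  have : 0 ≤ ∑ i, k i * (y' i j : ℝ) * (xi y X i t - xi y X i (t - τ i)) :=
    Finset.sum_nonneg fun i _ => mul_nonneg (mul_nonneg (h.kpos i).le (Nat.cast_nonneg _))
      (sub_nonneg.2 (h.xi_mono i (by linarith [h.t0 i])))
  linarith

lemma z_bd (h : Good y y' k τ τm M X) : ∃ Mz, ∀ t j, zz y y' k τ X t j ≤ Mz := by
  refine ⟨M + ∑ j, ∑ i, k i * (y' i j : ℝ) * ((∏ j, M ^ y i j) * τ i), fun t j => ?_⟩
  have hp : ∀ i, 0 ≤ ∏ j, M ^ y i j := fun i =>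
    Finset.prod_nonneg fun j _ => pow_nonneg (by linarith [h.M1]) _
  unfold zz
  refine add_le_add (h.bd t j) ?_
  refine le_trans ?_ (Finset.single_le_sum
    (f := fun j => ∑ i, k i * (y' i j : ℝ) * ((∏ j, M ^ y i j) * τ i))
    (fun j _ => Finset.sum_nonneg fun i _ => mul_nonneg (mul_nonneg (h.kpos i).le
      (Nat.cast_nonneg _)) (mul_nonneg (hp i) (h.t0 i))) (Finset.mem_univ j))
  refine Finset.sum_le_sum fun i _ => ?_
  refine mul_le_mul_of_nonneg_left ?_ (mul_nonneg (h.kpos i).le (Nat.cast_nonneg _))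
  have := h.xi_diff i (s := t - τ i) (t := t) (by linarith [h.t0 i])
  linarith [show (∏ j, M ^ y i j) * (t - (t - τ i)) = (∏ j, M ^ y i j) * τ i by ring]

lemma xi_der_shift (h : Good y y' k τ τm M X) (i : Fin r) (t : ℝ) :
    HasDerivAt (fun t => xi y X i (t - τ i)) (mono (X (t - τ i)) (y i)) t := by
  exact (h.xi_der i (t - τ i)).comp_sub_const t (τ i)

lemma z_der (h : Good y y' k τ τm M X) (t : ℝ) (ht : t > τm) (j : Fin n) :
    HasDerivAt (fun t => zz y y' k τ X t j)
      (∑ i, k i * mono (X t) (y i) * ((y' i j : ℝ) - y i j)) t := by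
  have h1 : HasDerivAt (fun t => ∑ i, k i * (y' i j : ℝ) * (xi y X i t - xi y X i (t - τ i)))
      (∑ i, k i * (y' i j : ℝ) * (mono (X t) (y i) - mono (X (t - τ i)) (y i))) t :=
    HasDerivAt.fun_sum fun i _ =>
      ((h.xi_der i t).sub (h.xi_der_shift i t)).const_mul _
  have h2 := (h.der t ht j).add h1
  refine HasDerivAt.congr_deriv (f := fun t => zz y y' k τ X t j) h2 ?_
  rw [← Finset.sum_add_distrib]
  refine Finset.sum_congr rfl fun i _ => ?_
  ring

lemma low (h : Good y y' k τ τm M X) (t : ℝ) (j : Fin n) :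
    (∑ i, k i * (y' i j : ℝ) * mono (X (t - τ i)) (y i)) - outC y k M * X t j ≤
    ∑ i, k i * (mono (X (t - τ i)) (y i) * (y' i j : ℝ) - mono (X t) (y i) * (y i j : ℝ)) := by
  have := outflow y k h.kpos h.M1 (fun j => (h.pos t j).le) (h.bd t) j
  have e : ∑ i, k i * (mono (X (t - τ i)) (y i) * (y' i j : ℝ) - mono (X t) (y i) * (y i j : ℝ))
    = (∑ i, k i * (y' i j : ℝ) * mono (X (t - τ i)) (y i)) -
      ∑ i, k i * (mono (X t) (y i) * (y i j : ℝ)) := by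
    rw [← Finset.sum_sub_distrib]
    exact Finset.sum_congr rfl fun i _ => by ring
  rw [e]; linarith

lemma exp_der (C a t : ℝ) : HasDerivAt (fun s => Real.exp (C * (s - a)))
    (C * Real.exp (C * (t - a))) t := by
  have := (((hasDerivAt_id t).sub_const a).const_mul C).exp
  simpa [mul_comm] using this

lemma inflow_nn (h : Good y y' k τ τm M X) (t : ℝ) (j : Fin n) (i : Fin r) :
    0 ≤ k i * (y' i j : ℝ) * mono (X (t - τ i)) (y i) :=
  mul_nonneg (mul_nonneg (h.kpos i).le (Nat.cast_nonneg _)) (mono_nn (fun j => (h.pos _ j).le) _)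

lemma compare (h : Good y y' k τ τm M X) (a : ℝ) (ha : a > τm) (T : ℝ) (hT : τm ≤ T)
    (j : Fin n) : zz y y' k τ X a j ≤ Real.exp (outC y k M * T) * X (a + T) j := by
  set C := outC y k M with hC
  have hC1 : 1 ≤ C := outC_ge y k h.kpos h.M1
  have hT0 : 0 ≤ T := h.tm0.trans hT
  have hd : ∀ u ∈ Set.Icc a (a + T), HasDerivAt
      (fun s => Real.exp (C * (s - a)) * X s j
        + ∑ i, k i * (y' i j : ℝ) * (xi y X i a - xi y X i (s - τ i)))
      ((C * Real.exp (C * (u - a)) * X u j + Real.exp (C * (u - a)) *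
        ∑ i, k i * (mono (X (u - τ i)) (y i) * (y' i j : ℝ) - mono (X u) (y i) * (y i j : ℝ)))
        + ∑ i, k i * (y' i j : ℝ) * (- mono (X (u - τ i)) (y i))) u := by
    intro u hu
    refine ((exp_der C a u).mul (h.der u (lt_of_lt_of_le ha hu.1) j)).add ?_
    refine HasDerivAt.fun_sum fun i _ => ?_
    exact (((h.xi_der_shift i u).const_sub _)).const_mul _
  have := mvt_lower (m := 0) (by linarith : a ≤ a + T) hd (by
    intro u hu
    have h1 := h.low u j
    have he : 1 ≤ Real.exp (C * (u - a)) :=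
      Real.one_le_exp (mul_nonneg (by linarith) (by linarith [hu.1]))
    have hI : 0 ≤ ∑ i, k i * (y' i j : ℝ) * mono (X (u - τ i)) (y i) :=
      Finset.sum_nonneg fun i _ => h.inflow_nn u j i
    have e : ∑ i, k i * (y' i j : ℝ) * (- mono (X (u - τ i)) (y i))
      = - ∑ i, k i * (y' i j : ℝ) * mono (X (u - τ i)) (y i) := by
      rw [← Finset.sum_neg_distrib]; exact Finset.sum_congr rfl fun i _ => by ring
    rw [e]
    have h2 := mul_le_mul_of_nonneg_left h1 (Real.exp_pos (C * (u - a))).le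
    nlinarith)
  have h3 : ∑ i, k i * (y' i j : ℝ) * (xi y X i a - xi y X i (a + T - τ i)) ≤ 0 :=
    Finset.sum_nonpos fun i _ => mul_nonpos_of_nonneg_of_nonpos
      (mul_nonneg (h.kpos i).le (Nat.cast_nonneg _))
      (sub_nonpos.2 (h.xi_mono i (by linarith [h.tm i])))
  unfold zz
  simp only [sub_self, mul_zero, Real.exp_zero, one_mul, zero_mul, add_zero, add_sub_cancel_left]
    at this
  linarith

/-- production from persistent reactants -/
lemma produce (h : Good y y' k τ τm M X) (i : Fin r) (j : Fin n) (hij : y' i j ≠ 0)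
    (hr : ∀ j', y i j' ≠ 0 → ∃ m > 0, ∀ᶠ t in atTop, m ≤ X t j') :
    ∃ m > 0, ∀ᶠ t in atTop, m ≤ X t j := by
  set C := outC y k M with hC
  have hC1 : 1 ≤ C := outC_ge y k h.kpos h.M1
  have hr' : ∀ j', ∃ m > 0, ∀ᶠ t in atTop, m ≤ X t j' ^ y i j' := by
    intro j'
    by_cases h0 : y i j' = 0
    · exact ⟨1, one_pos, by simp [h0]⟩
    · obtain ⟨m, hm, hev⟩ := hr j' h0
      exact ⟨m ^ y i j', pow_pos hm _, hev.mono fun t ht => pow_le_pow_left₀ hm.le ht _⟩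
  choose m hm hev using hr'
  have hev' := eventually_all.2 hev
  obtain ⟨t0, ht0⟩ := eventually_atTop.1 hev'
  set c := ∏ j, m j with hc
  have hcpos : 0 < c := Finset.prod_pos fun j _ => hm j
  have hmono : ∀ t ≥ t0, c ≤ mono (X t) (y i) := fun t ht =>
    Finset.prod_le_prod (fun j _ => (hm j).le) (fun j _ => ht0 t ht j)
  have hki := h.kpos i
  refine ⟨k i * c * Real.exp (-C), by positivity, ?_⟩
  filter_upwards [eventually_ge_atTop (max t0 0 + τm + 2)] with t ht
  set a := t - 1 with ha
  have hat : a > τm := by have := le_max_right t0 0; linarith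
  have hd : ∀ u ∈ Set.Icc a t, HasDerivAt
      (fun s => Real.exp (C * (s - a)) * X s j)
      (C * Real.exp (C * (u - a)) * X u j + Real.exp (C * (u - a)) *
        ∑ i, k i * (mono (X (u - τ i)) (y i) * (y' i j : ℝ) - mono (X u) (y i) * (y i j : ℝ)))
        u := fun u hu => (exp_der C a u).mul (h.der u (lt_of_lt_of_le hat hu.1) j)
  have := mvt_lower (m := k i * c) (by linarith : a ≤ t) hd (by
    intro u hu
    have h1 := h.low u j
    have he : 1 ≤ Real.exp (C * (u - a)) :=
      Real.one_le_exp (mul_nonneg (by linarith) (by linarith [hu.1]))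
    have hI : k i * c ≤ ∑ i, k i * (y' i j : ℝ) * mono (X (u - τ i)) (y i) := by
      refine le_trans ?_ (Finset.single_le_sum
        (f := fun i => k i * (y' i j : ℝ) * mono (X (u - τ i)) (y i))
        (fun i _ => h.inflow_nn u j i) (Finset.mem_univ i))
      have h1 : (1:ℝ) ≤ y' i j := by exact_mod_cast Nat.one_le_iff_ne_zero.2 hij
      have h2 := hmono (u - τ i) (by
        have := le_max_left t0 0; linarith [h.tm i, hu.1])
      exact mul_le_mul (by nlinarith) h2 hcpos.le (by positivity)
    have hkc : 0 ≤ k i * c := by positivity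
    have h2 := mul_le_mul_of_nonneg_left h1 (Real.exp_pos (C * (u - a))).le
    nlinarith)
  have hXa := h.pos a j
  simp only [sub_self, mul_zero, Real.exp_zero, one_mul] at this
  have e1 : t - a = 1 := by rw [ha]; ring
  rw [e1, mul_one, mul_one] at this
  have e2 : Real.exp C * Real.exp (-C) = 1 := by rw [← Real.exp_add]; simp
  have := mul_le_mul_of_nonneg_right (this) (Real.exp_pos (-C)).le
  have := Real.exp_pos (-C)
  have e3 : Real.exp C * X t j * Real.exp (-C) = X t j := by
    rw [mul_right_comm, e2, one_mul]
  nlinarith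

end Good


lemma make_good (y y' : Fin r → Fin n → ℕ) (k τ : Fin r → ℝ) (τm : ℝ)
    (hk : ∀ i, 0 < k i) (hτ : ∀ i, 0 ≤ τ i) (hτm : ∀ i, τ i ≤ τm) (hτm0 : 0 ≤ τm)
    (x : ℝ → Fin n → ℝ) (hs : IsSolution y y' k τ τm x) (hp : PosInit τm x)
    (hb : BoundedSol τm x) : ∃ M, Good y y' k τ τm M (fun t => x (max t 0)) := by
  obtain ⟨hnn, hcont, hder⟩ := hs
  obtain ⟨M0, hM0⟩ := hb
  set M := max 1 M0 with hM
  have hM1 : 1 ≤ M := le_max_left _ _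
  have hbd : ∀ t ≥ 0, ∀ j, x t j ≤ M := by
    intro t ht j
    have h1 := hM0 t (Set.mem_Ici.2 (by linarith))
    have h2 := (norm_le_pi_norm (x t) j)
    have h3 := le_abs_self (x t j)
    rw [Real.norm_eq_abs] at h2
    exact h3.trans (h2.trans (h1.trans (le_max_right _ _)))
  have hnn' : ∀ t ≥ -τm, ∀ j, 0 ≤ x t j := fun t ht j => hnn t ht j
  have hderj : ∀ t > 0, ∀ j, HasDerivAt (fun t => x t j)
      (∑ i, k i * (mono (x (t - τ i)) (y i) * (y' i j : ℝ) - mono (x t) (y i) * (y i j : ℝ))) t :=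
    fun t ht j => (hasDerivAt_pi.1 (hder t ht)) j
  set C := outC y k M with hC
  have hsub : Set.Ici (0:ℝ) ⊆ Set.Ici (-τm) := Set.Ici_subset_Ici.2 (by linarith)
  have hpos : ∀ t ≥ 0, ∀ j, 0 < x t j := by
    intro t ht j
    have hmon : MonotoneOn (fun s => Real.exp (C * (s - 0)) * x s j) (Set.Ici 0) := by
      have hd : ∀ u ∈ interior (Set.Ici (0:ℝ)), HasDerivAt
          (fun s => Real.exp (C * (s - 0)) * x s j) _ u := fun u hu =>
        (Good.exp_der C 0 u).mul (hderj u (by simpa using hu) j)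
      refine monotoneOn_of_deriv_nonneg (convex_Ici 0) ?_ ?_ ?_
      · refine ContinuousOn.mul (by fun_prop) ?_
        exact (continuous_apply j).comp_continuousOn (hcont.mono hsub)
      · exact fun u hu => (hd u hu).differentiableAt.differentiableWithinAt
      · intro u hu
        rw [(hd u hu).deriv]
        have hu0 : 0 < u := by simpa using hu
        have h1 := outflow y k hk hM1 (hnn' u (by linarith)) (hbd u hu0.le) j
        have h2 : 0 ≤ ∑ i, k i * (mono (x (u - τ i)) (y i) * (y' i j : ℝ)) :=
          Finset.sum_nonneg fun i _ => mul_nonneg (hk i).le (mul_nonneg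
            (mono_nn (hnn' _ (by linarith [hτm i])) _) (Nat.cast_nonneg _))
        have e : ∑ i, k i * (mono (x (u - τ i)) (y i) * (y' i j : ℝ)
            - mono (x u) (y i) * (y i j : ℝ))
            = (∑ i, k i * (mono (x (u - τ i)) (y i) * (y' i j : ℝ))) -
              ∑ i, k i * (mono (x u) (y i) * (y i j : ℝ)) := by
          rw [← Finset.sum_sub_distrib]
          exact Finset.sum_congr rfl fun i _ => by ring
        rw [e]
        have h3 := Real.exp_pos (C * (u - 0))
        have : 0 ≤ Real.exp (C * (u - 0)) * (C * x u j +
          ((∑ i, k i * (mono (x (u - τ i)) (y i) * (y' i j : ℝ))) -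
              ∑ i, k i * (mono (x u) (y i) * (y i j : ℝ)))) := mul_nonneg h3.le (by linarith)
        linarith
    have h0 := hmon (Set.mem_Ici.2 le_rfl) (Set.mem_Ici.2 ht) ht
    have h1 : 0 < x 0 j := hp 0 ⟨by linarith, le_rfl⟩ j
    simp only [sub_self, mul_zero, Real.exp_zero, one_mul] at h0
    exact pos_of_mul_pos_right (h1.trans_le h0) (Real.exp_pos _).le
  refine ⟨M, ?_, fun t j => hpos _ (le_max_right _ _) j, fun t j => hbd _ (le_max_right _ _) j,
    hM1, hk, hτ, hτm, hτm0, ?_⟩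
  · exact hcont.comp_continuous (by fun_prop) fun t => hsub (Set.mem_Ici.2 (le_max_right _ _))
  · intro t ht j
    have ht0 : 0 < t := lt_of_le_of_lt hτm0 ht
    have e1 : max t 0 = t := max_eq_left ht0.le
    have e2 : ∀ i, max (t - τ i) 0 = t - τ i := fun i => max_eq_left (by linarith [hτm i])
    simp only [e1, e2]
    refine (hderj t ht0 j).congr_of_eventuallyEq ?_
    filter_upwards [eventually_gt_nhds ht0] with s hs
    rw [max_eq_left hs.le]

lemma mono_split (x : Fin n → ℝ) (y : Fin n → ℕ) (W : Finset (Fin n)) :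
    mono x y = (∏ j ∈ univ \ W, x j ^ y j) *
      mon (fun j : {j // j ∈ W} => x j) (fun j => y j) := by
  unfold mono mon
  rw [← Finset.prod_sdiff (Finset.subset_univ W)]
  congr 1
  exact (Finset.prod_coe_sort W (fun j => x j ^ y j)).symm

lemma final_good {l : ℕ} (y y' : Fin r → Fin n → ℕ)
    (k τ : Fin r → ℝ) (τm M : ℝ)
    (Sp : Fin l → Set (Fin n)) (grp : Fin r → Fin l)
    (hcomb : IsCombination y y' Sp grp)
    (hsubCB : ∀ p, ComplexBalancedOn y y' k (Rgrp grp p))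
    (h2d : ∀ p, Module.finrank ℝ (stoichOn y y' (Rgrp grp p)) = 2)
    (hcase : ∀ W : Set (Fin n), Semilocking y y' Finset.univ W → W ∩ interSpecies Sp = ∅)
    (X : ℝ → Fin n → ℝ) (h : Good y y' k τ τm M X) (j : Fin n) :
    ∃ m > 0, ∀ᶠ t in atTop, m ≤ X t j := by
  classical
  by_contra hj
  set P : Fin n → Prop := fun j => ∃ m > 0, ∀ᶠ t in atTop, m ≤ X t j with hP
  have hsl : Semilocking y y' Finset.univ {j | ¬ P j} := by
    refine ⟨⟨j, hj⟩, fun i _ hi => ?_⟩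
    obtain ⟨j', hj', hij⟩ := hi
    by_contra hcon
    push Not at hcon
    refine hj' (h.produce i j' hij fun j'' hj'' => ?_)
    by_contra hn
    exact hj'' (hcon j'' hn)
  have hint := hcase _ hsl
  obtain ⟨p, hp⟩ := hcomb.1 j
  set R := Rgrp grp p with hR
  set W : Finset (Fin n) := univ.filter (fun j => ¬ P j ∧ j ∈ Sp p) with hW
  have hWmem : ∀ j, j ∈ W ↔ ¬ P j ∧ j ∈ Sp p := fun j => by simp [hW]
  have hjW : j ∈ W := (hWmem j).2 ⟨hj, hp⟩
  -- species of `W` only in reactions of `R`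
  have honly : ∀ i ∉ R, ∀ j ∈ W, y i j = 0 ∧ y' i j = 0 := by
    intro i hi j hjW
    by_contra hcon
    have hne : y i j ≠ 0 ∨ y' i j ≠ 0 := by tauto
    have h1 := hcomb.2 i j hne
    have h2 : grp i ≠ p := fun e => hi (by simp [hR, Rgrp, e])
    have h3 : j ∈ {j | ¬ P j} ∩ interSpecies Sp :=
      ⟨((hWmem j).1 hjW).1, grp i, p, h2, h1, ((hWmem j).1 hjW).2⟩
    rw [hint] at h3
    exact h3
  -- bounds on outer species
  have hout : ∀ i ∈ R, ∀ j ∉ W, y i j ≠ 0 → P j := by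
    intro i hi j hjn hne
    by_contra hcon
    refine hjn ((hWmem j).2 ⟨hcon, ?_⟩)
    have := hcomb.2 i j (Or.inl hne)
    rwa [(by simpa [hR, Rgrp] using hi : grp i = p)] at this
  have hlow : ∀ i : {i // i ∈ R}, ∃ c > 0, ∀ᶠ t in atTop,
      c ≤ k i * ∏ j ∈ univ \ W, X t j ^ y i j := by
    intro i
    have h1 : ∀ j, ∃ c > 0, j ∈ univ \ W → ∀ᶠ t in atTop, c ≤ X t j ^ y i j := by
      intro j
      by_cases hjW : j ∈ W
      · exact ⟨1, one_pos, fun hh => absurd hjW (Finset.mem_sdiff.1 hh).2⟩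
      by_cases h0 : y i j = 0
      · exact ⟨1, one_pos, fun _ => by simp [h0]⟩
      · obtain ⟨m, hm, hev⟩ := hout i i.2 j hjW h0
        exact ⟨m ^ y i j, pow_pos hm _, fun _ => hev.mono fun t ht => pow_le_pow_left₀ hm.le ht _⟩
    choose c hc hev using h1
    refine ⟨k i * ∏ j ∈ univ \ W, c j, mul_pos (h.kpos i) (Finset.prod_pos fun j _ => hc j), ?_⟩
    have hall : ∀ᶠ t in atTop, ∀ j, j ∈ univ \ W → c j ≤ X t j ^ y i j :=
      eventually_all.2 fun j => by
        by_cases hh : j ∈ univ \ W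
        · exact (hev j hh).mono fun t ht _ => ht
        · exact Eventually.of_forall fun t ht => absurd ht hh
    refine hall.mono fun t ht => ?_
    exact mul_le_mul_of_nonneg_left (Finset.prod_le_prod (fun j _ => (hc j).le) ht) (h.kpos i).le
  choose c hc hev using hlow
  obtain ⟨m, hm, hmc⟩ := exists_low univ c (fun i _ => hc i)
  obtain ⟨t1, ht1⟩ := eventually_atTop.1 (eventually_all.2 hev)
  have hup : ∀ t, ∀ i : {i // i ∈ R}, k i * ∏ j ∈ univ \ W, X t j ^ y i j ≤
      m + ∑ i, k i * ∏ j ∈ univ \ W, M ^ y i j := by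
    intro t i
    have h1 : k i * ∏ j ∈ univ \ W, X t j ^ y i j ≤ k i * ∏ j ∈ univ \ W, M ^ y i j :=
      mul_le_mul_of_nonneg_left (Finset.prod_le_prod (fun j _ => pow_nonneg (h.pos t j).le _)
        (fun j _ => pow_le_pow_left₀ (h.pos t j).le (h.bd t j) _)) (h.kpos i).le
    have h2 := Finset.single_le_sum (f := fun i => k i * ∏ j ∈ univ \ W, M ^ y i j)
      (fun i _ => mul_nonneg (h.kpos i).le (Finset.prod_nonneg fun j _ =>
        pow_nonneg (by linarith [h.M1]) _)) (Finset.mem_univ (i : Fin r))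
    linarith
  obtain ⟨Mz, hMz⟩ := h.z_bd
  have hM0 : m ≤ m + ∑ i, k i * ∏ j ∈ univ \ W, M ^ y i j := by
    have : 0 ≤ ∑ i, k i * ∏ j ∈ univ \ W, M ^ y i j := Finset.sum_nonneg fun i _ =>
      mul_nonneg (h.kpos i).le (Finset.prod_nonneg fun j _ => pow_nonneg (by linarith [h.M1]) _)
    linarith
  have hC1 : 1 ≤ outC y k M := outC_ge y k h.kpos h.M1
  have hT0 : 0 < τm + 1 := by linarith [h.tm0]
  have key := core (J := {j // j ∈ W}) (ι := {i // i ∈ R}) (fun i j => y i j) (fun i j => y' i j)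
    ((stoichOn y y' R).map (LinearMap.funLeft ℝ ℝ (Subtype.val : {j // j ∈ W} → Fin n)))
    (wr_of_cb y y' k h.kpos R (hsubCB p) W)
    ((Submodule.finrank_map_le _ _).trans (h2d p).le)
    (fun i => Submodule.mem_map.2 ⟨_, Submodule.subset_span ⟨i, i.2, rfl⟩, by
      ext j; simp [LinearMap.funLeft_apply]⟩)
    m (m + ∑ i, k i * ∏ j ∈ univ \ W, M ^ y i j) hm hM0
    (Real.exp (outC y k M * (τm + 1)))
    (Real.one_le_exp (mul_nonneg (by linarith) hT0.le))
    (max t1 (τm + 1)) (τm + 1) hT0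
    (fun t j => zz y y' k τ X t j) (fun t j => X t j)
    (fun t i => k i * ∏ j ∈ univ \ W, X t j ^ y i j) Mz
    (fun t ht i => ⟨(hmc i (Finset.mem_univ _)).trans (ht1 t ((le_max_left _ _).trans ht) i),
      hup t i⟩)
    (fun t _ j => ⟨h.pos t j, h.x_le_z t j, hMz t j⟩)
    (fun t ht j => by
      have := h.compare (t - (τm + 1)) (by
        have := le_max_right t1 (τm + 1); linarith) (τm + 1) (by linarith) j
      rwa [sub_add_cancel] at this)
    (fun t ht j => by
      refine (h.z_der t (by have := le_max_right t1 (τm + 1); linarith) j).congr_deriv ?_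
      have e1 : ∑ i, k i * mono (X t) (y i) * ((y' i j : ℝ) - y i j)
          = ∑ i ∈ R, k i * mono (X t) (y i) * ((y' i j : ℝ) - y i j) := by
        symm
        refine Finset.sum_subset (Finset.subset_univ _) fun i _ hi => ?_
        obtain ⟨h1, h2⟩ := honly i hi j j.2
        rw [h1, h2]; simp
      rw [e1, ← Finset.sum_coe_sort R]
      refine Finset.sum_congr rfl fun i _ => ?_
      rw [mono_split (X t) (y i) W]; ring)
    ⟨j, hjW⟩
  obtain ⟨δ, hδ, t0, hz⟩ := key
  refine hj ⟨δ * Real.exp (-(outC y k M * (τm + 1))), by positivity, ?_⟩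
  filter_upwards [eventually_ge_atTop (max t0 (τm + 1) + (τm + 1))] with t ht
  have h1 := h.compare (t - (τm + 1)) (by
    have := le_max_right t0 (τm + 1); linarith) (τm + 1) (by linarith) j
  rw [sub_add_cancel] at h1
  have h2 := hz (t - (τm + 1)) (by have := le_max_left t0 (τm + 1); linarith)
  have h3 : δ ≤ Real.exp (outC y k M * (τm + 1)) * X t j := le_trans h2 h1
  have e2 : Real.exp (outC y k M * (τm + 1)) * Real.exp (-(outC y k M * (τm + 1))) = 1 := by
    rw [← Real.exp_add]; simp
  calc δ * Real.exp (-(outC y k M * (τm + 1)))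
      ≤ Real.exp (outC y k M * (τm + 1)) * X t j * Real.exp (-(outC y k M * (τm + 1))) :=
        mul_le_mul_of_nonneg_right h3 (Real.exp_pos _).le
    _ = X t j := by rw [mul_right_comm, e2, one_mul]

theorem stmt4 {n r l : ℕ} (y y' : Fin r → Fin n → ℕ)
    (k τ : Fin r → ℝ) (τm : ℝ)
    (hk : ∀ i, 0 < k i) (hτ : ∀ i, 0 ≤ τ i) (hτm : ∀ i, τ i ≤ τm) (hτm0 : 0 ≤ τm)
    (hCB : ComplexBalancedOn y y' k Finset.univ)
    (Sp : Fin l → Set (Fin n)) (grp : Fin r → Fin l)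
    (hcomb : IsCombination y y' Sp grp)
    (hsubCB : ∀ p, ComplexBalancedOn y y' k (Rgrp grp p))
    (h2d : ∀ p, Module.finrank ℝ (stoichOn y y' (Rgrp grp p)) = 2)
    (hcase : ∀ W : Set (Fin n), Semilocking y y' Finset.univ W →
      (∃ p, Semilocking y y' (Rgrp grp p) (W ∩ Sp p) ∧
        FacetType (stoichOn y y' (Rgrp grp p)) (W ∩ Sp p)) ∧
      W ∩ interSpecies Sp = ∅) :
    Persistent y y' k τ τm := by
  intro x hs hp hb j
  obtain ⟨M, hg⟩ := make_good y y' k τ τm hk hτ hτm hτm0 x hs hp hb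
  obtain ⟨m, hm, hev⟩ := final_good y y' k τ τm M Sp grp hcomb hsubCB h2d
    (fun W hW => (hcase W hW).2) _ hg j
  have hev' : ∀ᶠ t in atTop, m ≤ x t j := by
    filter_upwards [hev, eventually_ge_atTop (0:ℝ)] with t ht h0
    rwa [max_eq_left h0] at ht
  refine hm.trans_le (le_liminf_of_le ?_ hev')
  refine IsBoundedUnder.isCoboundedUnder_ge ⟨M, ?_⟩
  rw [eventually_map]
  filter_upwards [eventually_ge_atTop (0:ℝ)] with t h0
  have := hg.bd t j
  rwa [max_eq_left h0] at this
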